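/- arXiv:1405.6700 — 12 statements merged into one kernel-verified Lean document; each statement's English description precedes it below -/
import Mathlib

section
/- Let m ≥ 1 and l ≥ 0, and let Φ_{ml} be the finite frame with points b₁,…,b_m, a₁,…,a_l and relation R given by: b_j R b_k for all j,k; b_j R a_i for all j,i; a_i R a_i for all i (an m-element root cluster below l reflexive maximal points). Let X be a dense-in-itself separable metric space and B ⊆ X a closed nowhere dense set. Then there exists a surjective map g : X → Φ_{ml} such that: (i) d(g⁻¹(w)) = g⁻¹(R⁻¹(w)) for every point w of Φ_{ml}, i.e. d(g⁻¹(a_i)) = g⁻¹(a_i) ∪ g⁻¹({b₁,…,b_m}) for each i and d(g⁻¹(b_j)) = g⁻¹({b₁,…,b_m}) for each j; (ii) B ⊆ g⁻¹(b₁); (iii) for every i ≤ l there is a family α_i of pairwise disjoint nonempty open metric balls whose union is g⁻¹(a_i) and which is dense at every point of g⁻¹({b₁,…,b_m}). -/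
open TopologicalSpace

/-- The relation of the frame `Φ_{ml}`: an `m`-element root cluster
`b₁,…,b_m` (encoded as `Sum.inl j`) below `l` reflexive maximal points
`a₁,…,a_l` (encoded as `Sum.inr i`). -/
def PhiRel (m l : ℕ) : (Fin m ⊕ Fin l) → (Fin m ⊕ Fin l) → Prop
  | Sum.inl _, _ => True
  | Sum.inr i, Sum.inr i' => i = i'
  | Sum.inr _, Sum.inl _ => False

open Set Topology

/-- In a second countable space, a real function takes only countably many values at its local
maxima. -/
theorem countable_image_isLocalMax {X : Type*} [TopologicalSpace X] [SecondCountableTopology X]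
    (f : X → ℝ) : (f '' {x | IsLocalMax f x}).Countable := by
  refine ((countable_countableBasis X).image fun V ↦ sSup (f '' V)).mono ?_
  rintro _ ⟨x, hx, rfl⟩
  obtain ⟨V, hV, hxV, hVf⟩ := (isBasis_countableBasis X).mem_nhds_iff.1 hx
  exact ⟨V, hV, IsGreatest.csSup_eq ⟨mem_image_of_mem f hxV, forall_mem_image.2 fun y hy ↦ hVf hy⟩⟩

section LabelledBall

variable {X : Type*} [MetricSpace X] {m l : ℕ}

/-- A ball carrying a label: `Sum.inl i` for a ball to be mapped to `aᵢ`, and `Sum.inr (j, b)` for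
a degenerate ball, i.e. a point, to be mapped to `b_j`. Having two labels for each `j` ensures
that near any point there is a point labelled by `j` other than the given one. -/
structure LabelledBall (X : Type*) (m l : ℕ) where
  label : Fin l ⊕ (Fin m × Bool)
  center : X
  radius : ℝ

namespace LabelledBall

/-- The open ball underlying a labelled ball. -/
def ball (t : LabelledBall X m l) : Set X := Metric.ball t.center t.radius

/-- The closed ball underlying a labelled ball. -/
def closedBall (t : LabelledBall X m l) : Set X := Metric.closedBall t.center t.radius

theorem ball_subset_closedBall (t : LabelledBall X m l) : t.ball ⊆ t.closedBall :=
  Metric.ball_subset_closedBall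

/-- A labelled ball is admissible for `B` if it misses `B`, each of its boundary points is a limit
of points outside it, and its radius is positive or zero according to the label. -/
structure Admissible (B : Set X) (t : LabelledBall X m l) : Prop where
  radius_pos : ∀ i, t.label = Sum.inl i → 0 < t.radius
  radius_eq_zero : ∀ k, t.label = Sum.inr k → t.radius = 0
  disjoint : Disjoint t.closedBall B
  boundary : t.closedBall \ t.ball ⊆ closure t.closedBallᶜ

theorem Admissible.center_mem {B : Set X} {t : LabelledBall X m l} (ht : t.Admissible B) :
    t.center ∈ t.closedBall := by
  apply Metric.mem_closedBall_self
  rcases h : t.label with i | k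
  · exact (ht.radius_pos i h).le
  · exact (ht.radius_eq_zero k h).ge

theorem exists_admissible_subset [SeparableSpace X] [PerfectSpace X] {B W : Set X}
    (hW : IsOpen W) (hne : W.Nonempty) (hWB : Disjoint W B) (k : Fin l ⊕ (Fin m × Bool)) :
    ∃ t : LabelledBall X m l, t.Admissible B ∧ t.label = k ∧ t.closedBall ⊆ W := by
  have := UniformSpace.secondCountable_of_separable X
  obtain ⟨p, hp⟩ := hne
  rcases k with i | k
  · obtain ⟨ε, hε, hεW⟩ := Metric.isOpen_iff.1 hW p hp
    obtain ⟨ρ, hρ, hρ0, hρε⟩ :=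
      ((countable_image_isLocalMax fun x ↦ dist x p).dense_compl ℝ).exists_between hε
    have hsub : Metric.closedBall p ρ ⊆ W := (Metric.closedBall_subset_ball hρε).trans hεW
    refine ⟨⟨.inl i, p, ρ⟩, ⟨fun _ _ ↦ hρ0, by simp, hWB.mono_left hsub, ?_⟩, rfl, hsub⟩
    rintro y ⟨hy, hy'⟩
    have hyρ : dist y p = ρ := le_antisymm hy (not_lt.1 hy')
    rw [mem_closure_iff_nhds]
    intro V hV
    by_contra hVe
    refine hρ ⟨y, ?_, hyρ⟩
    filter_upwards [hV] with z hz
    rw [hyρ]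
    by_contra hlt
    exact hVe ⟨z, hz, hlt⟩
  · have hsub : Metric.closedBall p 0 ⊆ W := by simpa using hp
    refine ⟨⟨.inr k, p, 0⟩, ⟨by simp, fun _ _ ↦ rfl, hWB.mono_left hsub, ?_⟩, rfl, hsub⟩
    intro y _
    simp [closedBall]

/-- A set of labelled balls is a packing avoiding `B` if its members are admissible and have
pairwise disjoint closed balls. -/
structure IsPacking (B : Set X) (S : Set (LabelledBall X m l)) : Prop where
  admissible : ∀ t ∈ S, t.Admissible B
  pairwise : S.Pairwise fun s t ↦ Disjoint s.closedBall t.closedBall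

/-- A finite packing whose open balls do not cover an open set `V` leaves some room in `V`. -/
theorem IsPacking.nonempty_diff {B : Set X} {S : Set (LabelledBall X m l)} (hS : IsPacking B S)
    (hfin : S.Finite) {V : Set X} (hV : IsOpen V) (hcov : ¬ V ⊆ ⋃ t ∈ S, t.ball) :
    (V \ ⋃ t ∈ S, t.closedBall).Nonempty := by
  obtain ⟨y, hyV, hy⟩ := not_subset.1 hcov
  by_cases hyc : y ∈ ⋃ t ∈ S, t.closedBall
  swap
  · exact ⟨y, hyV, hyc⟩
  simp only [mem_iUnion, exists_prop, not_exists, not_and] at hyc hy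
  obtain ⟨t, ht, hyt⟩ := hyc
  have hclosed : IsClosed (⋃ s ∈ S \ {t}, s.closedBall) :=
    hfin.sdiff.isClosed_biUnion fun s _ ↦ Metric.isClosed_closedBall
  have hmem : y ∈ V \ ⋃ s ∈ S \ {t}, s.closedBall := by
    refine ⟨hyV, ?_⟩
    simp only [mem_iUnion, exists_prop, not_exists, not_and]
    rintro s ⟨hs, hst⟩ hys
    exact disjoint_left.1 (hS.pairwise hs ht hst) hys hyt
  obtain ⟨z, ⟨hzV, hz⟩, hzt⟩ := mem_closure_iff.1 ((hS.admissible t ht).boundary ⟨hyt, hy t ht⟩)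
    _ (hV.sdiff hclosed) hmem
  refine ⟨z, hzV, fun hzc ↦ ?_⟩
  simp only [mem_iUnion, exists_prop] at hzc hz
  obtain ⟨s, hs, hzs⟩ := hzc
  exact hz ⟨s, ⟨hs, fun h ↦ hzt (h ▸ hzs)⟩, hzs⟩

theorem IsPacking.exists_extension [SeparableSpace X] [PerfectSpace X] {B : Set X}
    (hBclosed : IsClosed B) (hBnwd : IsNowhereDense B) {S : Set (LabelledBall X m l)}
    (hS : IsPacking B S) (hfin : S.Finite) {V : Set X} (hV : IsOpen V)
    (k : Fin l ⊕ (Fin m × Bool)) :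
    ∃ S', S'.Finite ∧ IsPacking B S' ∧ S ⊆ S' ∧
      (V ⊆ (⋃ t ∈ S', t.ball) ∨ ∃ t ∈ S', t.label = k ∧ t.closedBall ⊆ V) := by
  by_cases hcov : V ⊆ ⋃ t ∈ S, t.ball
  · exact ⟨S, hfin, hS, Subset.rfl, .inl hcov⟩
  have hopen : IsOpen (V \ ⋃ t ∈ S, t.closedBall) :=
    hV.sdiff (hfin.isClosed_biUnion fun s _ ↦ Metric.isClosed_closedBall)
  have hdense : Dense Bᶜ := by
    rw [← interior_eq_empty_iff_dense_compl, ← hBclosed.closure_eq]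
    exact hBnwd
  obtain ⟨t, ht, htk, htW⟩ := exists_admissible_subset (hopen.sdiff hBclosed)
    (hdense.inter_open_nonempty _ hopen (hS.nonempty_diff hfin hV hcov)) disjoint_sdiff_left k
  have hdisj : ∀ s ∈ S, Disjoint t.closedBall s.closedBall := fun s hs ↦
    disjoint_left.2 fun x hxt hxs ↦ (htW hxt).1.2 (mem_biUnion hs hxs)
  refine ⟨insert t S, hfin.insert t, ⟨forall_mem_insert.2 ⟨ht, hS.admissible⟩, ?_⟩,
    subset_insert t S, .inr ⟨t, mem_insert t S, htk, fun x hx ↦ (htW hx).1.1⟩⟩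
  exact hS.pairwise.insert fun s hs _ ↦ ⟨hdisj s hs, (hdisj s hs).symm⟩

/-- There is a packing whose members with any given label accumulate at every point that is not
covered by the open balls. -/
theorem exists_isPacking_dense [SeparableSpace X] [PerfectSpace X] {B : Set X}
    (hBclosed : IsClosed B) (hBnwd : IsNowhereDense B) :
    ∃ T : Set (LabelledBall X m l), IsPacking B T ∧
      ∀ x ∉ ⋃ t ∈ T, t.ball, ∀ V ∈ 𝓝 x, ∀ k, ∃ t ∈ T, t.label = k ∧ t.closedBall ⊆ V := by
  have := UniformSpace.secondCountable_of_separable X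
  rcases isEmpty_or_nonempty (Fin l ⊕ (Fin m × Bool)) with hk | hk
  · exact ⟨∅, ⟨by simp, by simp⟩, fun _ _ _ _ k ↦ hk.elim k⟩
  rcases isEmpty_or_nonempty X with hX | ⟨⟨x₀⟩⟩
  · exact ⟨∅, ⟨by simp, by simp⟩, fun x ↦ hX.elim x⟩
  obtain ⟨U₀, hU₀, -⟩ := (isBasis_countableBasis X).exists_subset_of_mem_open
    (mem_univ x₀) isOpen_univ
  have : Nonempty (countableBasis X) := ⟨⟨U₀, hU₀⟩⟩
  have : Countable (countableBasis X) := (countable_countableBasis X).to_subtype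
  obtain ⟨e, he⟩ := exists_surjective_nat (countableBasis X × (Fin l ⊕ (Fin m × Bool)))
  have step (n : ℕ) (S : {S : Set (LabelledBall X m l) // S.Finite ∧ IsPacking B S}) :
      ∃ S' : {S : Set (LabelledBall X m l) // S.Finite ∧ IsPacking B S}, S.1 ⊆ S'.1 ∧
        (((e n).1 : Set X) ⊆ (⋃ t ∈ S'.1, t.ball) ∨
          ∃ t ∈ S'.1, t.label = (e n).2 ∧ t.closedBall ⊆ (e n).1) := by
    obtain ⟨S', hfin, hS', h⟩ := S.2.2.exists_extension hBclosed hBnwd S.2.1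
      (isOpen_of_mem_countableBasis (e n).1.2) (e n).2
    exact ⟨⟨S', hfin, hS'⟩, h⟩
  choose next hsub hnext using step
  let S (n : ℕ) : {S : Set (LabelledBall X m l) // S.Finite ∧ IsPacking B S} :=
    Nat.rec ⟨∅, finite_empty, by simp, by simp⟩ next n
  have hmono : Monotone fun n ↦ (S n).1 := monotone_nat_of_le_succ fun n ↦ hsub n (S n)
  refine ⟨⋃ n, (S n).1, ⟨?_, ?_⟩, ?_⟩
  · intro t ht
    obtain ⟨n, hn⟩ := mem_iUnion.1 ht
    exact (S n).2.2.admissible t hn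
  · exact (pairwise_iUnion hmono.directed_le).2 fun n ↦ (S n).2.2.pairwise
  · intro x hx V hV k
    obtain ⟨U, hU, hxU, hUV⟩ := (isBasis_countableBasis X).mem_nhds_iff.1 hV
    obtain ⟨n, hn⟩ := he (⟨U, hU⟩, k)
    have hsucc : (S (n + 1)).1 ⊆ ⋃ n, (S n).1 := subset_iUnion (fun n ↦ (S n).1) (n + 1)
    have h := hnext n (S n)
    rw [hn] at h
    rcases h with h | ⟨t, ht, htk, htU⟩
    · exact absurd (biUnion_subset_biUnion_left hsucc (h hxU)) hx
    · exact ⟨t, hsucc ht, htk, htU.trans hUV⟩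

theorem IsPacking.eq_of_mem {B : Set X} {T : Set (LabelledBall X m l)} (hT : IsPacking B T)
    {s t : LabelledBall X m l} (hs : s ∈ T) (ht : t ∈ T) {x : X} (hxs : x ∈ s.closedBall)
    (hxt : x ∈ t.closedBall) : s = t :=
  hT.pairwise.eq hs ht (not_disjoint_iff.2 ⟨x, hxs, hxt⟩)

open Classical in
/-- The map given by the labels of a packing; points not in the packing are sent to `b`. -/
noncomputable def toPhi (T : Set (LabelledBall X m l)) (b : Fin m) (x : X) : Fin m ⊕ Fin l :=
  if h : ∃ i, ∃ t ∈ T, t.label = Sum.inl i ∧ x ∈ t.ball then Sum.inr h.choose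
  else if h : ∃ j, ∃ t ∈ T, ∃ c, t.label = Sum.inr (j, c) ∧ x = t.center then Sum.inl h.choose
  else Sum.inl b

theorem IsPacking.toPhi_eq_inr_iff {B : Set X} {T : Set (LabelledBall X m l)} (hT : IsPacking B T)
    {b : Fin m} {x : X} {i : Fin l} :
    toPhi T b x = Sum.inr i ↔ ∃ t ∈ T, t.label = Sum.inl i ∧ x ∈ t.ball := by
  constructor
  · intro h
    unfold toPhi at h
    split_ifs at h with h₁
    obtain rfl := Sum.inr_injective h
    exact h₁.choose_spec
  · rintro ⟨t, ht, hti, hxt⟩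
    have h : ∃ i, ∃ t ∈ T, t.label = Sum.inl i ∧ x ∈ t.ball := ⟨i, t, ht, hti, hxt⟩
    obtain ⟨s, hs, hsi, hxs⟩ := h.choose_spec
    obtain rfl := hT.eq_of_mem hs ht (s.ball_subset_closedBall hxs) (t.ball_subset_closedBall hxt)
    rw [toPhi, dif_pos h]
    exact congrArg _ (Sum.inl_injective (hsi.symm.trans hti))

theorem IsPacking.notMem_ball_iff {B : Set X} {T : Set (LabelledBall X m l)} (hT : IsPacking B T)
    {b : Fin m} {x : X} :
    x ∉ (⋃ t ∈ T, t.ball) ↔ ∃ j, toPhi T b x = Sum.inl j := by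
  rcases h : toPhi T b x with j | i
  · simp only [Sum.inl.injEq, exists_eq', iff_true, mem_iUnion, exists_prop, not_exists, not_and]
    intro t ht hxt
    rcases hk : t.label with i | k
    · simp [hT.toPhi_eq_inr_iff.2 ⟨t, ht, hk, hxt⟩] at h
    · simp [ball, (hT.admissible t ht).radius_eq_zero k hk] at hxt
  · obtain ⟨t, ht, -, hxt⟩ := hT.toPhi_eq_inr_iff.1 h
    simpa using ⟨t, ht, hxt⟩

theorem IsPacking.toPhi_center {B : Set X} {T : Set (LabelledBall X m l)} (hT : IsPacking B T)
    {b : Fin m} {t : LabelledBall X m l} (ht : t ∈ T) {j : Fin m} {c : Bool}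
    (htj : t.label = Sum.inr (j, c)) : toPhi T b t.center = Sum.inl j := by
  have hc := (hT.admissible t ht).center_mem
  have h₁ : ¬ ∃ i, ∃ s ∈ T, s.label = Sum.inl i ∧ t.center ∈ s.ball := by
    rintro ⟨i, s, hs, hsi, hts⟩
    obtain rfl := hT.eq_of_mem hs ht (s.ball_subset_closedBall hts) hc
    simp [htj] at hsi
  have h₂ : ∃ j, ∃ s ∈ T, ∃ c, s.label = Sum.inr (j, c) ∧ t.center = s.center :=
    ⟨j, t, ht, c, htj, rfl⟩
  obtain ⟨s, hs, c', hsj, hts⟩ := h₂.choose_spec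
  obtain rfl := hT.eq_of_mem hs ht (hts ▸ (hT.admissible s hs).center_mem) hc
  rw [toPhi, dif_neg h₁, dif_pos h₂]
  exact congrArg _ (Prod.ext_iff.1 (Sum.inr_injective (hsj.symm.trans htj))).1

theorem IsPacking.toPhi_of_mem {B : Set X} {T : Set (LabelledBall X m l)} (hT : IsPacking B T)
    {b : Fin m} {x : X} (hx : x ∈ B) : toPhi T b x = Sum.inl b := by
  have hxT : ∀ t ∈ T, x ∉ t.closedBall := fun t ht hxt ↦
    disjoint_left.1 (hT.admissible t ht).disjoint hxt hx
  rw [toPhi, dif_neg, dif_neg]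
  · rintro ⟨j, t, ht, c, -, rfl⟩
    exact hxT t ht (hT.admissible t ht).center_mem
  · rintro ⟨i, t, ht, -, hxt⟩
    exact hxT t ht (t.ball_subset_closedBall hxt)

end LabelledBall

end LabelledBall

open LabelledBall in
/-- extended McKinsey–Tarski lemma: every dense-in-itself separable
metric space admits a d-morphism onto `Φ_{ml}` sending a given closed nowhere
dense set `B` into the preimage of `b₁`, where each `g⁻¹(aᵢ)` is the union of a
family of disjoint nonempty open balls dense at every point of the preimage of
the root cluster. -/
theorem dMorphism_onto_Phi_ml
    {X : Type*} [MetricSpace X] [Nonempty X] [SeparableSpace X] [PerfectSpace X]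
    (m l : ℕ) (hm : 1 ≤ m)
    (B : Set X) (hBclosed : IsClosed B) (hBnwd : IsNowhereDense B) :
    ∃ g : X → (Fin m ⊕ Fin l), Function.Surjective g ∧
      (∀ w, derivedSet (g ⁻¹' {w}) = g ⁻¹' {v | PhiRel m l v w}) ∧
      B ⊆ g ⁻¹' {Sum.inl ⟨0, hm⟩} ∧
      (∀ i : Fin l, ∃ α : Set (Set X),
        (∀ U ∈ α, ∃ (c : X) (ρ : ℝ), 0 < ρ ∧ U = Metric.ball c ρ ∧ U.Nonempty) ∧
        α.Pairwise Disjoint ∧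
        ⋃₀ α = g ⁻¹' {Sum.inr i} ∧
        (∀ x, g x ∈ Set.range (Sum.inl : Fin m → Fin m ⊕ Fin l) →
          ∀ V ∈ nhds x, ∃ U ∈ α, U ⊆ V)) := by
  obtain ⟨x₀⟩ := ‹Nonempty X›
  have hnwd : IsNowhereDense (B ∪ {x₀}) := by
    have hint : interior (B ∪ {x₀}) = ∅ := by
      rw [interior_union_isClosed_of_interior_empty hBclosed (interior_singleton x₀),
        ← hBclosed.closure_eq]
      exact hBnwd
    rwa [IsNowhereDense, (hBclosed.union isClosed_singleton).closure_eq]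
  obtain ⟨T, hT, hdense⟩ := exists_isPacking_dense (m := m) (l := l)
    (hBclosed.union isClosed_singleton) hnwd
  set g := toPhi T ⟨0, hm⟩ with hg
  have hroot (x : X) (j : Fin m) (hx : g x = Sum.inl j) (V : Set X) (hV : V ∈ 𝓝 x)
      (k : Fin l ⊕ (Fin m × Bool)) : ∃ t ∈ T, t.label = k ∧ t.closedBall ⊆ V :=
    hdense x (hT.notMem_ball_iff.2 ⟨j, hx⟩) V hV k
  have hopen (i : Fin l) : IsOpen (g ⁻¹' {Sum.inr i}) := by
    have : g ⁻¹' {Sum.inr i} = ⋃ t ∈ {t ∈ T | t.label = Sum.inl i}, t.ball := by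
      ext x
      simp [hg, hT.toPhi_eq_inr_iff, and_assoc]
    rw [this]
    exact isOpen_biUnion fun t _ ↦ Metric.isOpen_ball
  have hacc (x : X) (j : Fin m) (hx : g x = Sum.inl j) (w : Fin m ⊕ Fin l) :
      AccPt x (Filter.principal (g ⁻¹' {w})) := by
    rw [accPt_iff_nhds]
    intro V hV
    rcases w with j' | i
    · obtain ⟨s, hs, hsj, hsV⟩ := hroot x j hx V hV (Sum.inr (j', true))
      obtain ⟨t, ht, htj, htV⟩ := hroot x j hx V hV (Sum.inr (j', false))
      by_cases hxs : s.center = x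
      · refine ⟨t.center, ⟨htV (hT.admissible t ht).center_mem, hT.toPhi_center ht htj⟩, ?_⟩
        intro hxt
        obtain rfl := hT.eq_of_mem hs ht (hxs ▸ (hT.admissible s hs).center_mem)
          (hxt ▸ (hT.admissible t ht).center_mem)
        simp [hsj] at htj
      · exact ⟨s.center, ⟨hsV (hT.admissible s hs).center_mem, hT.toPhi_center hs hsj⟩, hxs⟩
    · obtain ⟨t, ht, hti, htV⟩ := hroot x j hx V hV (Sum.inl i)
      have hgt : g t.center = Sum.inr i := hT.toPhi_eq_inr_iff.2
        ⟨t, ht, hti, Metric.mem_ball_self ((hT.admissible t ht).radius_pos i hti)⟩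
      refine ⟨t.center, ⟨htV (hT.admissible t ht).center_mem, hgt⟩, ?_⟩
      rintro rfl
      simp [hx] at hgt
  have hgx₀ : g x₀ = Sum.inl ⟨0, hm⟩ := hT.toPhi_of_mem (.inr rfl)
  refine ⟨g, fun w ↦ ?_, fun w ↦ ?_, fun x hx ↦ hT.toPhi_of_mem (.inl hx), fun i ↦ ?_⟩
  · obtain ⟨y, ⟨-, hy⟩, -⟩ := accPt_iff_nhds.1 (hacc x₀ _ hgx₀ w) univ Filter.univ_mem
    exact ⟨y, hy⟩
  · ext x
    rw [mem_derivedSet, mem_preimage, mem_ofPred_eq]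
    rcases hx : g x with j | i
    · exact iff_of_true (hacc x j hx w) trivial
    · have hxi : g ⁻¹' {Sum.inr i} ∈ 𝓝 x := (hopen i).mem_nhds hx
      by_cases hw : w = Sum.inr i
      · subst hw
        exact iff_of_true ((hopen i).preperfect x hx) rfl
      · refine iff_of_false (fun h ↦ ?_) ?_
        · obtain ⟨y, ⟨hyi, hyw⟩, -⟩ := accPt_iff_nhds.1 h _ hxi
          exact hw (hyw.symm.trans hyi)
        · rcases w with j | i'
          · exact id
          · rintro (rfl : i = i')
            exact hw rfl
  · refine ⟨LabelledBall.ball '' {t ∈ T | t.label = Sum.inl i}, ?_, ?_, ?_, ?_⟩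
    · rintro _ ⟨t, ⟨ht, hti⟩, rfl⟩
      have hpos := (hT.admissible t ht).radius_pos i hti
      exact ⟨t.center, t.radius, hpos, rfl, t.center, Metric.mem_ball_self hpos⟩
    · rintro _ ⟨s, ⟨hs, -⟩, rfl⟩ _ ⟨t, ⟨ht, -⟩, rfl⟩ hst
      exact (hT.pairwise hs ht fun h ↦ hst (h ▸ rfl)).mono
        s.ball_subset_closedBall t.ball_subset_closedBall
    · ext x
      simp [hg, hT.toPhi_eq_inr_iff, and_assoc]
    · rintro x ⟨j, hj⟩ V hV
      obtain ⟨t, ht, hti, htV⟩ := hroot x j hj.symm V hV (Sum.inl i)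
      exact ⟨t.ball, ⟨t, ⟨ht, hti⟩, rfl⟩, t.ball_subset_closedBall.trans htV⟩
end

section
/- Let X be a dense-in-itself separable metric space and B ⊆ X a closed nowhere dense set. Let (W,R) be a finite transitive serial frame with W = C ∪ W₁ ∪ … ∪ W_l (l ≥ 0), where C = {b₁,…,b_m} (m ≥ 1) satisfies c R c' for all c,c' ∈ C and c R w for every c ∈ C and w ∈ W, each W_i is disjoint from C, upward closed (R(W_i) ⊆ W_i), and generated by a single point x_i ∈ W_i (W_i = {x_i} ∪ R(x_i)). Assume that for every nonempty open metric ball U ⊆ X and every i ∈ {1,…,l} there is a surjective map g : U → W_i with d_U(g⁻¹(w)) = g⁻¹(R⁻¹(w) ∩ W_i) for all w ∈ W_i (derived sets in the subspace U). Then there is a surjective f : X → W with d(f⁻¹(w)) = f⁻¹(R⁻¹(w)) for all w ∈ W and f(B) ⊆ {b₁}. -/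
open TopologicalSpace Set Filter Topology

/-- A map `X → W` under construction. On the open set `region` it already satisfies the
d-morphism condition; on the closed set `core`, which `region` stays away from, it takes
values in `C`; elsewhere its values are provisional. -/
structure PartialDMorphism (X : Type*) [TopologicalSpace X] {W : Type*}
    (R : W → W → Prop) (C : Set W) where
  toFun : X → W
  core : Set X
  region : Set X
  isClosed_core : IsClosed core
  dense_compl_core : Dense coreᶜ
  interior_closure_region : interior (closure region) = region
  disjoint_closure_region_core : Disjoint (closure region) core
  map_core : ∀ x ∈ core, toFun x ∈ C
  frequently_iff : ∀ x ∈ region, ∀ w, (∃ᶠ y in 𝓝[≠] x, toFun y = w) ↔ R (toFun x) w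

namespace PartialDMorphism

section Topological

variable {X : Type*} [TopologicalSpace X] {W : Type*} {R : W → W → Prop} {C : Set W}

theorem isOpen_region (s : PartialDMorphism X R C) : IsOpen s.region :=
  s.interior_closure_region ▸ isOpen_interior

/-- `t` extends `s` if it decides more points and agrees with `s` on those decided by `s`. -/
structure Extends (s t : PartialDMorphism X R C) : Prop where
  core_subset : s.core ⊆ t.core
  region_subset : s.region ⊆ t.region
  eqOn : EqOn t.toFun s.toFun (s.core ∪ s.region)

theorem Extends.refl (s : PartialDMorphism X R C) : s.Extends s :=
  ⟨Subset.rfl, Subset.rfl, fun _ _ => rfl⟩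

theorem Extends.trans {s t u : PartialDMorphism X R C} (hst : s.Extends t) (htu : t.Extends u) :
    s.Extends u :=
  ⟨hst.core_subset.trans htu.core_subset, hst.region_subset.trans htu.region_subset,
    fun _ hx => (htu.eqOn (union_subset_union hst.core_subset hst.region_subset hx)).trans
      (hst.eqOn hx)⟩

instance : IsPreorder (PartialDMorphism X R C) Extends where
  refl := Extends.refl
  trans _ _ _ := Extends.trans

/-- Every point of `O` that is not in the region of `s` sees the value `w` at another decided
point of `O`. -/
def Hits (s : PartialDMorphism X R C) (O : Set X) (w : W) : Prop :=
  ∀ x ∈ O, x ∉ s.region → ∃ y ∈ O ∩ (s.core ∪ s.region), y ≠ x ∧ s.toFun y = w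

/-- An open set not contained in the region has undecided points, away from the region. -/
theorem exists_isOpen_subset_undecided (s : PartialDMorphism X R C) {O : Set X} (hO : IsOpen O)
    (h : ¬ O ⊆ s.region) :
    ∃ U ⊆ O, IsOpen U ∧ U.Nonempty ∧ Disjoint U (closure s.region) ∧ Disjoint U s.core := by
  refine ⟨(O \ closure s.region) ∩ s.coreᶜ, fun x hx => hx.1.1,
    (hO.sdiff isClosed_closure).inter s.isClosed_core.isOpen_compl, ?_,
    disjoint_left.2 fun x hx => hx.1.2, disjoint_left.2 fun x hx => hx.2⟩
  refine s.dense_compl_core.inter_open_nonempty _ (hO.sdiff isClosed_closure) ?_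
  rw [sdiff_nonempty]
  intro hsub
  exact h (s.interior_closure_region ▸ interior_maximal hsub hO)

open Classical in
/-- Decide a point outside the closure of the region, giving it a value in `C`. -/
noncomputable def insertCore [T1Space X] [PerfectSpace X] (s : PartialDMorphism X R C) (p : X)
    (hp : p ∉ closure s.region) (c : W) (hc : c ∈ C) : PartialDMorphism X R C where
  toFun := Function.update s.toFun p c
  core := insert p s.core
  region := s.region
  isClosed_core := isClosed_singleton.union s.isClosed_core
  dense_compl_core := by
    have := s.dense_compl_core.sdiff_singleton p
    convert this using 1
    ext x
    simp [and_comm]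
  interior_closure_region := s.interior_closure_region
  disjoint_closure_region_core := by
    rw [disjoint_insert_right]
    exact ⟨hp, s.disjoint_closure_region_core⟩
  map_core x hx := by
    by_cases h : x = p
    · simpa [h] using hc
    · simpa [h] using s.map_core x (hx.resolve_left h)
  frequently_iff x hx w := by
    have hne : ∀ y ∈ s.region, y ≠ p := fun y hy h => hp (h ▸ subset_closure hy)
    rw [Function.update_of_ne (hne x hx), ← s.frequently_iff x hx w]
    refine frequently_congr ?_
    filter_upwards [nhdsWithin_le_nhds (s.isOpen_region.mem_nhds hx)] with y hy
    rw [Function.update_of_ne (hne y hy)]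

theorem extends_insertCore [T1Space X] [PerfectSpace X] (s : PartialDMorphism X R C) (p : X)
    (hp : p ∉ closure s.region) (hp' : p ∉ s.core) (c : W) (hc : c ∈ C) :
    s.Extends (s.insertCore p hp c hc) := by
  refine ⟨subset_insert _ _, Subset.rfl, fun x hx => ?_⟩
  classical
  simp only [insertCore]
  rw [Function.update_of_ne]
  rintro rfl
  exact hx.elim hp' fun h => hp (subset_closure h)

open Classical in
/-- Decide an open set `V`, away from everything decided so far, by means of a map `g` which
satisfies the d-morphism condition on `V`. -/
noncomputable def unionRegion (s : PartialDMorphism X R C) (V : Set X) (g : X → W)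
    (hV : interior (closure V) = V) (hVs : Disjoint (closure V) (closure s.region))
    (hVc : Disjoint (closure V) s.core)
    (hg : ∀ x ∈ V, ∀ w, (∃ᶠ y in 𝓝[≠] x, g y = w) ↔ R (g x) w) : PartialDMorphism X R C where
  toFun := V.piecewise g s.toFun
  core := s.core
  region := s.region ∪ V
  isClosed_core := s.isClosed_core
  dense_compl_core := s.dense_compl_core
  interior_closure_region := by
    refine Subset.antisymm ?_ (interior_maximal subset_closure
      (s.isOpen_region.union (hV ▸ isOpen_interior)))
    rw [closure_union]
    intro x hx
    obtain hxs | hxV := interior_subset hx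
    · left
      have hxV : x ∉ closure V := fun h => disjoint_left.1 hVs h hxs
      rw [← s.interior_closure_region, mem_interior_iff_mem_nhds]
      filter_upwards [isOpen_interior.mem_nhds hx,
        isClosed_closure.isOpen_compl.mem_nhds hxV] with y hy hyV
      exact (interior_subset hy).resolve_right hyV
    · right
      have hxs : x ∉ closure s.region := fun h => disjoint_left.1 hVs hxV h
      rw [← hV, mem_interior_iff_mem_nhds]
      filter_upwards [isOpen_interior.mem_nhds hx,
        isClosed_closure.isOpen_compl.mem_nhds hxs] with y hy hys
      exact (interior_subset hy).resolve_left hys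
  disjoint_closure_region_core := by
    rw [closure_union]
    exact s.disjoint_closure_region_core.union_left hVc
  map_core x hx := by
    have hxV : x ∉ V := fun h => disjoint_left.1 hVc (subset_closure h) hx
    simpa [hxV] using s.map_core x hx
  frequently_iff x hx w := by
    obtain hx | hx := hx
    · have hnot : ∀ y ∈ s.region, y ∉ V := fun y hy h =>
        disjoint_left.1 hVs (subset_closure h) (subset_closure hy)
      rw [piecewise_eq_of_notMem _ _ _ (hnot x hx), ← s.frequently_iff x hx w]
      refine frequently_congr ?_
      filter_upwards [nhdsWithin_le_nhds (s.isOpen_region.mem_nhds hx)] with y hy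
      rw [piecewise_eq_of_notMem _ _ _ (hnot y hy)]
    · have hVo : IsOpen V := hV ▸ isOpen_interior
      rw [piecewise_eq_of_mem _ _ _ hx, ← hg x hx w]
      refine frequently_congr ?_
      filter_upwards [nhdsWithin_le_nhds (hVo.mem_nhds hx)] with y hy
      rw [piecewise_eq_of_mem _ _ _ hy]

theorem extends_unionRegion (s : PartialDMorphism X R C) (V : Set X) (g : X → W)
    (hV : interior (closure V) = V) (hVs : Disjoint (closure V) (closure s.region))
    (hVc : Disjoint (closure V) s.core)
    (hg : ∀ x ∈ V, ∀ w, (∃ᶠ y in 𝓝[≠] x, g y = w) ↔ R (g x) w) :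
    s.Extends (s.unionRegion V g hV hVs hVc hg) := by
  refine ⟨Subset.rfl, subset_union_left, fun x hx => ?_⟩
  classical
  simp only [unionRegion]
  rw [piecewise_eq_of_notMem]
  intro h
  exact hx.elim (disjoint_left.1 hVc (subset_closure h))
    fun hx => disjoint_left.1 hVs (subset_closure h) (subset_closure hx)

theorem exists_extends_hits_of_mem [T1Space X] [PerfectSpace X] (s : PartialDMorphism X R C)
    {O : Set X} (hO : IsOpen O) {c : W} (hc : c ∈ C) : ∃ t, s.Extends t ∧ t.Hits O c := by
  by_cases h : O ⊆ s.region
  · exact ⟨s, .refl s, fun x hx hx' => absurd (h hx) hx'⟩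
  obtain ⟨U, hUO, hU, ⟨p, hp⟩, hUs, hUc⟩ := s.exists_isOpen_subset_undecided hO h
  obtain ⟨q, ⟨hqp, hq⟩⟩ : ({p}ᶜ ∩ U).Nonempty :=
    (dense_compl_singleton p).inter_open_nonempty U hU ⟨p, hp⟩ |>.mono fun x hx => ⟨hx.2, hx.1⟩
  have hqp : q ≠ p := hqp
  have hpE := disjoint_left.1 hUs hp
  have hqE := disjoint_left.1 hUs hq
  have hq' : q ∉ (s.insertCore p hpE c hc).core := by
    rintro (h | h)
    exacts [hqp h, disjoint_left.1 hUc hq h]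
  refine ⟨(s.insertCore p hpE c hc).insertCore q hqE c hc,
    (s.extends_insertCore p hpE (disjoint_left.1 hUc hp) c hc).trans
      (extends_insertCore (s.insertCore p hpE c hc) q hqE hq' c hc), fun x _ _ => ?_⟩
  by_cases hxp : p = x
  · refine ⟨q, ⟨hUO hq, .inl (mem_insert _ _)⟩, hxp ▸ hqp, ?_⟩
    simp [insertCore]
  · refine ⟨p, ⟨hUO hp, .inl (mem_insert_of_mem _ (mem_insert _ _))⟩, hxp, ?_⟩
    simp [insertCore, hqp.symm]

end Topological

/-- The d-morphism condition on an open subspace, read off in the ambient space. -/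
theorem frequently_extend_iff {X : Type*} [TopologicalSpace X] {W : Type*} {R : W → W → Prop}
    {U : Set X} (hU : IsOpen U) {Y : Set W} (hup : ∀ w ∈ Y, ∀ v, R w v → v ∈ Y)
    {g : U → W} (hgY : ∀ u, g u ∈ Y)
    (hg : ∀ w ∈ Y, derivedSet (g ⁻¹' {w}) = g ⁻¹' ({v | R v w} ∩ Y)) (e : X → W) (u : U) (w : W) :
    (∃ᶠ y in 𝓝[≠] (u : X), Function.extend Subtype.val g e y = w) ↔ R (g u) w := by
  have hmap : map Subtype.val (𝓝[≠] u) = 𝓝[≠] (u : X) := by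
    rw [← hU.isOpenEmbedding_subtypeVal.map_nhdsWithin_preimage_eq]
    congr 2
    ext x
    simp [Subtype.ext_iff]
  rw [← hmap, frequently_map]
  simp only [Subtype.val_injective.extend_apply]
  by_cases hw : w ∈ Y
  · have := Set.ext_iff.1 (hg w hw) u
    rw [mem_derivedSet, accPt_iff_frequently_nhdsNE] at this
    simpa [hgY u] using this
  · refine iff_of_false (fun h => ?_) fun h => hw (hup _ (hgY u) _ h)
    obtain ⟨y, hy⟩ := h.exists
    exact hw (hy ▸ hgY y)

theorem exists_extends_hits_of_ball {X : Type*} [MetricSpace X] {W : Type*} {R : W → W → Prop}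
    {C : Set W} (s : PartialDMorphism X R C) {Y : Set W}
    (hup : ∀ w ∈ Y, ∀ v, R w v → v ∈ Y)
    (hball : ∀ (c : X) (ρ : ℝ), 0 < ρ → ∃ g : (Metric.ball c ρ) → W,
      (∀ u, g u ∈ Y) ∧ (∀ w ∈ Y, ∃ u, g u = w) ∧
      (∀ w ∈ Y, derivedSet (g ⁻¹' {w}) = g ⁻¹' ({v | R v w} ∩ Y)))
    {O : Set X} (hO : IsOpen O) {w : W} (hw : w ∈ Y) : ∃ t, s.Extends t ∧ t.Hits O w := by
  by_cases h : O ⊆ s.region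
  · exact ⟨s, .refl s, fun x hx hx' => absurd (h hx) hx'⟩
  obtain ⟨U, hUO, hU, ⟨p, hp⟩, hUs, hUc⟩ := s.exists_isOpen_subset_undecided hO h
  obtain ⟨ρ, hρ, hρU⟩ := Metric.isOpen_iff.1 hU p hp
  obtain ⟨g, hgY, hgsurj, hg⟩ := hball p ρ hρ
  obtain ⟨u, rfl⟩ := hgsurj w hw
  obtain ⟨r, hr, hrρ⟩ := Metric.nhds_basis_closedBall.mem_iff.1
    (Metric.isOpen_ball.mem_nhds u.2)
  set V := interior (closure (Metric.ball (u : X) r))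
  have hclV : closure V ⊆ Metric.ball p ρ :=
    (closure_minimal interior_subset isClosed_closure).trans
      (Metric.closure_ball_subset_closedBall.trans hrρ)
  have hV : interior (closure V) = V := interior_closure_idem
  have huV : (u : X) ∈ V :=
    interior_maximal subset_closure Metric.isOpen_ball (Metric.mem_ball_self hr)
  have hsub : V ⊆ Metric.ball p ρ := subset_closure.trans hclV
  have hgV : ∀ x ∈ V, ∀ w, (∃ᶠ y in 𝓝[≠] x, Function.extend Subtype.val g s.toFun y = w) ↔
      R (Function.extend Subtype.val g s.toFun x) w := by
    intro x hx w
    lift x to Metric.ball p ρ using hsub hx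
    rw [Subtype.val_injective.extend_apply]
    exact frequently_extend_iff Metric.isOpen_ball hup hgY hg s.toFun x w
  refine ⟨_, s.extends_unionRegion V _ hV (hUs.mono_left (hclV.trans hρU))
    (hUc.mono_left (hclV.trans hρU)) hgV, fun x _ hx => ?_⟩
  refine ⟨u, ⟨hUO (hρU u.2), .inr (.inr huV)⟩, fun hux => hx (.inr (hux ▸ huV)), ?_⟩
  simp [unionRegion, huV]

/-- If every partial d-morphism can be extended so as to hit a given value in a given open set,
then it extends to a total one. -/
theorem exists_dMorphism {X : Type*} [TopologicalSpace X] [SecondCountableTopology X] [Nonempty X]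
    {W : Type*} [Countable W] {R : W → W → Prop} {C : Set W}
    (hCroot : ∀ c ∈ C, ∀ w, R c w) {b : W} (hb : b ∈ C)
    (hstep : ∀ (s : PartialDMorphism X R C) (O : Set X), IsOpen O → ∀ w,
      ∃ t, s.Extends t ∧ t.Hits O w) (s₀ : PartialDMorphism X R C) :
    ∃ f : X → W, EqOn f s₀.toFun s₀.core ∧
      ∀ x w, (∃ᶠ y in 𝓝[≠] x, f y = w) ↔ R (f x) w := by
  classical
  have : Nonempty (countableBasis X × W) := by
    obtain ⟨O, hO, -⟩ := (isBasis_countableBasis X).mem_nhds_iff.1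
      (univ_mem : univ ∈ 𝓝 (Classical.arbitrary X))
    exact ⟨⟨O, hO⟩, b⟩
  obtain ⟨task, htask⟩ := exists_surjective_nat (countableBasis X × W)
  choose next hext hhits using fun (n : ℕ) (s : PartialDMorphism X R C) =>
    hstep s (task n).1 (isOpen_of_mem_countableBasis (task n).1.2) (task n).2
  let S : ℕ → PartialDMorphism X R C := fun n => Nat.rec s₀ next n
  have hmono : ∀ {m n : ℕ}, m ≤ n → (S m).Extends (S n) := fun h =>
    Nat.rel_of_forall_rel_succ_of_le Extends (fun n => hext n (S n)) h
  let f : X → W := fun x =>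
    if h : ∃ n, x ∈ (S n).core ∪ (S n).region then (S h.choose).toFun x else b
  have hf : ∀ n, ∀ x ∈ (S n).core ∪ (S n).region, f x = (S n).toFun x := by
    intro n x hx
    have h : ∃ n, x ∈ (S n).core ∪ (S n).region := ⟨n, hx⟩
    simp only [f, dif_pos h]
    obtain hle | hle := le_total h.choose n
    · exact ((hmono hle).eqOn h.choose_spec).symm
    · exact (hmono hle).eqOn hx
  refine ⟨f, fun x hx => hf 0 x (.inl hx), fun x w => ?_⟩
  by_cases hx : ∃ n, x ∈ (S n).region
  · obtain ⟨n, hx⟩ := hx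
    rw [hf n x (.inr hx), ← (S n).frequently_iff x hx w]
    refine frequently_congr ?_
    filter_upwards [nhdsWithin_le_nhds ((S n).isOpen_region.mem_nhds hx)] with y hy
    rw [hf n y (.inr hy)]
  push Not at hx
  have hfC : f x ∈ C := by
    by_cases h : ∃ n, x ∈ (S n).core
    · obtain ⟨n, h⟩ := h
      rw [hf n x (.inl h)]
      exact (S n).map_core x h
    · push Not at h
      rwa [show f x = b from dif_neg (by simp [h, hx])]
  refine iff_of_true ?_ (hCroot _ hfC w)
  rw [frequently_nhdsWithin_iff, (isBasis_countableBasis X).nhds_hasBasis.frequently_iff]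
  rintro O ⟨hO, hxO⟩
  obtain ⟨n, hn⟩ := htask (⟨O, hO⟩, w)
  have hhit : (S (n + 1)).Hits O w := by simpa only [hn] using hhits n (S n)
  obtain ⟨y, ⟨hyO, hy⟩, hyx, hyw⟩ := hhit x hxO (hx (n + 1))
  exact ⟨y, hyO, (hf (n + 1) y hy).trans hyw, hyx⟩

end PartialDMorphism

/-- if a finite transitive serial frame `W` consists of a nonempty
root cluster `C` (with `b₁ ∈ C`) seeing everything, together with generated
subframes `W₁,…,W_l` each of which is a d-morphic image of every nonempty open
ball of a dense-in-itself separable metric space `X`, then there is a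
d-morphism `f : X → W` sending a given closed nowhere dense set `B` to `b₁`. -/
theorem dMorphism_onto_frame_with_root_cluster
    {X : Type*} [MetricSpace X] [Nonempty X] [SeparableSpace X] [PerfectSpace X]
    (B : Set X) (hBclosed : IsClosed B) (hBnwd : IsNowhereDense B)
    {W : Type*} [Finite W] (R : W → W → Prop)
    (htrans : Transitive R) (hserial : ∀ w, ∃ v, R w v)
    (C : Set W) (b₁ : W) (hb₁ : b₁ ∈ C)
    (hCcluster : ∀ c ∈ C, ∀ c' ∈ C, R c c')
    (hCroot : ∀ c ∈ C, ∀ w : W, R c w)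
    (l : ℕ) (Wi : Fin l → Set W) (xi : Fin l → W)
    (hcover : Set.univ = C ∪ ⋃ i, Wi i)
    (hdisjC : ∀ i, Disjoint (Wi i) C)
    (hup : ∀ i, ∀ w ∈ Wi i, ∀ v, R w v → v ∈ Wi i)
    (hgen : ∀ i, Wi i = {xi i} ∪ {w | R (xi i) w})
    (hball : ∀ (c : X) (ρ : ℝ), 0 < ρ → ∀ i : Fin l,
      ∃ g : (Metric.ball c ρ) → W,
        (∀ u, g u ∈ Wi i) ∧
        (∀ w ∈ Wi i, ∃ u, g u = w) ∧
        (∀ w ∈ Wi i, derivedSet (g ⁻¹' {w}) = g ⁻¹' ({v | R v w} ∩ Wi i))) :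
    ∃ f : X → W, Function.Surjective f ∧
      (∀ w, derivedSet (f ⁻¹' {w}) = f ⁻¹' {v | R v w}) ∧
      (∀ x ∈ B, f x = b₁) := by
  have hstep : ∀ (s : PartialDMorphism X R C) (O : Set X), IsOpen O → ∀ w,
      ∃ t, s.Extends t ∧ t.Hits O w := by
    intro s O hO w
    obtain hw | hw := hcover.subset (mem_univ w)
    · exact s.exists_extends_hits_of_mem hO hw
    · obtain ⟨i, hi⟩ := mem_iUnion.1 hw
      exact s.exists_extends_hits_of_ball (hup i) (fun c ρ hρ => hball c ρ hρ i) hO hi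
  have : SecondCountableTopology X := UniformSpace.secondCountable_of_separable X
  let x₀ : X := Classical.arbitrary X
  have hBdense : Dense Bᶜ := by
    rwa [← interior_eq_empty_iff_dense_compl, ← hBclosed.closure_eq]
  let s : PartialDMorphism X R C :=
    { toFun := fun _ => b₁
      core := B
      region := ∅
      isClosed_core := hBclosed
      dense_compl_core := hBdense
      interior_closure_region := by simp
      disjoint_closure_region_core := by simp
      map_core := fun _ _ => hb₁
      frequently_iff := by simp }
  obtain ⟨f, hfs, hf⟩ := PartialDMorphism.exists_dMorphism hCroot hb₁ hstep
    (s.insertCore x₀ (by simp [s]) b₁ hb₁)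
  have hfb : ∀ x ∈ insert x₀ B, f x = b₁ := fun x hx => by
    simpa [PartialDMorphism.insertCore, s] using hfs hx
  refine ⟨f, fun w => ?_, fun w => ?_, fun x hx => hfb x (.inr hx)⟩
  · exact ((hf x₀ w).2 (hfb x₀ (.inl rfl) ▸ hCroot b₁ hb₁ w)).exists
  · ext x
    rw [mem_derivedSet, accPt_iff_frequently_nhdsNE]
    exact hf x w
end

section
/- (Glueing lemma, case (a)) Let X be a topological space in which every point is locally closed (for every x there is an open U ∋ x with closure({x}) ∩ U = {x}). Suppose X = X₁ ∪ Y ∪ X₂ where X₁, Y, X₂ are closed and nonempty, X₁ ∩ X₂ = X₁ ∩ int(Y) = X₂ ∩ int(Y) = ∅, ∂X₁ ∪ ∂X₂ = ∂Y, and d(int(Y)) = Y. Let (W,R) be a finite transitive frame, W₁, W₂ ⊆ W upward closed (R(W_i) ⊆ W_i) with W = W₁ ∪ W₂, and let C ⊆ W₁ ∩ W₂ be nonempty with c R c' for all c,c' ∈ C and R(c) ⊆ C for every c ∈ C (a common maximal cluster). Suppose f_i : X_i → W_i (i = 1,2) are surjective with d_{X_i}(f_i⁻¹(w)) = f_i⁻¹(R⁻¹(w)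 ∩ W_i) for all w ∈ W_i, f_i(∂X_i) ⊆ {v ∈ W | ∃ c ∈ C, v R c}, and g : int(Y) → C is surjective with d_{int Y}(g⁻¹(c)) = int(Y) for every c ∈ C. Then X is the disjoint union of X₁, X₂ and int(Y), and the map f equal to f₁ on X₁, f₂ on X₂ and g on int(Y) is surjective onto W and satisfies d(f⁻¹(w)) = f⁻¹(R⁻¹(w)) for all w ∈ W. -/
open Topology Filter in
theorem accPt_coe_image_iff {X : Type*} [TopologicalSpace X] {S : Set X} {A : Set S} {x : S} :
    AccPt (x : X) (𝓟 ((↑) '' A)) ↔ AccPt x (𝓟 A) := by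
  simp only [accPt_iff_nhds]
  constructor
  · intro h U hU
    obtain ⟨V, hV, hVU⟩ := mem_nhds_subtype S x U |>.1 hU
    obtain ⟨_, ⟨hyV, a, ha, rfl⟩, hne⟩ := h V hV
    exact ⟨a, ⟨hVU hyV, ha⟩, fun e => hne (congrArg _ e)⟩
  · intro h U hU
    obtain ⟨a, ⟨haU, ha⟩, hne⟩ := h _
      (preimage_coe_mem_nhds_subtype.2 (mem_nhdsWithin_of_mem_nhds hU))
    exact ⟨a, ⟨haU, a, ha, rfl⟩, fun e => hne (Subtype.ext e)⟩

theorem derivedSet_coe_image_of_isClosed {X : Type*} [TopologicalSpace X] {S : Set X}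
    (hS : IsClosed S) (A : Set S) :
    derivedSet ((↑) '' A : Set X) = (↑) '' derivedSet A := by
  ext x
  constructor
  · intro hx
    have hxS : x ∈ S :=
      closure_minimal (Subtype.coe_image_subset S A) hS (derivedSet_subset_closure _ hx)
    exact ⟨⟨x, hxS⟩, accPt_coe_image_iff.1 hx, rfl⟩
  · rintro ⟨y, hy, rfl⟩
    exact accPt_coe_image_iff.2 hy

/-- A map from a closed subspace into an upward closed subset `V` that satisfies the d-morphism
condition at the points of `V` satisfies it at every point, with derived sets taken in the
whole space. -/
theorem derivedSet_coe_image_fiber {X W : Type*} [TopologicalSpace X] {S : Set X}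
    (hS : IsClosed S) {R : W → W → Prop} {V : Set W} (hup : ∀ w ∈ V, ∀ v, R w v → v ∈ V)
    {h : S → W} (hinto : ∀ x, h x ∈ V)
    (hd : ∀ w ∈ V, derivedSet (h ⁻¹' {w}) = h ⁻¹' ({v | R v w} ∩ V)) (w : W) :
    derivedSet ((↑) '' (h ⁻¹' {w}) : Set X) = (↑) '' (h ⁻¹' {v | R v w}) := by
  rw [derivedSet_coe_image_of_isClosed hS]
  congr 1
  by_cases hw : w ∈ V
  · rw [hd w hw]
    ext x
    simp [hinto x]
  · have hempty : h ⁻¹' {w} = ∅ :=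
      Set.eq_empty_of_forall_notMem fun x hx => hw (hx ▸ hinto x)
    have hempty' : h ⁻¹' {v | R v w} = ∅ :=
      Set.eq_empty_of_forall_notMem fun x hx => hw (hup _ (hinto x) _ hx)
    rw [hempty, hempty']
    exact Set.eq_empty_of_forall_notMem fun x hx => by
      simpa using derivedSet_subset_closure _ hx

/-- the Glueing lemma, case (a). -/
theorem glueing_lemma_case_a
    {X : Type*} [TopologicalSpace X]
    (hloc : ∀ x : X, ∃ U : Set X, IsOpen U ∧ x ∈ U ∧ closure {x} ∩ U = {x})
    (X₁ Y X₂ : Set X)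
    (hX₁closed : IsClosed X₁) (hYclosed : IsClosed Y) (hX₂closed : IsClosed X₂)
    (hX₁ne : X₁.Nonempty) (hYne : Y.Nonempty) (hX₂ne : X₂.Nonempty)
    (hcover : X₁ ∪ Y ∪ X₂ = Set.univ)
    (h12 : X₁ ∩ X₂ = ∅) (h1Y : X₁ ∩ interior Y = ∅) (h2Y : X₂ ∩ interior Y = ∅)
    (hbd : frontier X₁ ∪ frontier X₂ = frontier Y)
    (hYreg : derivedSet (interior Y) = Y)
    {W : Type*} [Finite W] (R : W → W → Prop) (htrans : Transitive R)
    (W₁ W₂ : Set W)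
    (hup₁ : ∀ w ∈ W₁, ∀ v, R w v → v ∈ W₁) (hup₂ : ∀ w ∈ W₂, ∀ v, R w v → v ∈ W₂)
    (hWcover : W₁ ∪ W₂ = Set.univ)
    (C : Set W) (hCne : C.Nonempty) (hC12 : C ⊆ W₁ ∩ W₂)
    (hCcluster : ∀ c ∈ C, ∀ c' ∈ C, R c c')
    (hCmax : ∀ c ∈ C, ∀ w, R c w → w ∈ C)
    (f₁ : X₁ → W) (f₂ : X₂ → W)
    (hf₁into : ∀ x, f₁ x ∈ W₁) (hf₂into : ∀ x, f₂ x ∈ W₂)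
    (hf₁onto : ∀ w ∈ W₁, ∃ x, f₁ x = w) (hf₂onto : ∀ w ∈ W₂, ∃ x, f₂ x = w)
    (hf₁d : ∀ w ∈ W₁, derivedSet (f₁ ⁻¹' {w}) = f₁ ⁻¹' ({v | R v w} ∩ W₁))
    (hf₂d : ∀ w ∈ W₂, derivedSet (f₂ ⁻¹' {w}) = f₂ ⁻¹' ({v | R v w} ∩ W₂))
    (hf₁bd : ∀ x : X₁, (x : X) ∈ frontier X₁ → ∃ c ∈ C, R (f₁ x) c)
    (hf₂bd : ∀ x : X₂, (x : X) ∈ frontier X₂ → ∃ c ∈ C, R (f₂ x) c)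
    (g : interior Y → W)
    (hginto : ∀ y, g y ∈ C) (hgonto : ∀ c ∈ C, ∃ y, g y = c)
    (hgd : ∀ c ∈ C, derivedSet (g ⁻¹' {c}) = Set.univ) :
    (X₁ ∪ X₂ ∪ interior Y = Set.univ ∧ X₁ ∩ X₂ = ∅ ∧
      X₁ ∩ interior Y = ∅ ∧ X₂ ∩ interior Y = ∅) ∧
    ∃ f : X → W,
      (∀ x : X₁, f x = f₁ x) ∧ (∀ x : X₂, f x = f₂ x) ∧
      (∀ y : interior Y, f y = g y) ∧
      Function.Surjective f ∧
      (∀ w, derivedSet (f ⁻¹' {w}) = f ⁻¹' {v | R v w}) := by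
  classical
  have hfr₁ := hX₁closed.frontier_subset
  have hfr₂ := hX₂closed.frontier_subset
  have hYsub : Y ⊆ interior Y ∪ (frontier X₁ ∪ frontier X₂) := by
    intro x hx
    by_cases hi : x ∈ interior Y
    · exact Or.inl hi
    · rw [hbd, hYclosed.frontier_eq]
      exact Or.inr ⟨hx, hi⟩
  have hpart : ∀ x, x ∈ X₁ ∨ x ∈ X₂ ∨ x ∈ interior Y := by
    intro x
    rcases hcover.symm ▸ Set.mem_univ x with (h | h) | h
    · exact Or.inl h
    · rcases hYsub h with h | h | h
      · exact Or.inr (Or.inr h)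
      · exact Or.inl (hfr₁ h)
      · exact Or.inr (Or.inl (hfr₂ h))
    · exact Or.inr (Or.inl h)
  refine ⟨⟨Set.eq_univ_of_forall fun x => ?_, h12, h1Y, h2Y⟩, ?_⟩
  · rcases hpart x with h | h | h
    · exact Or.inl (Or.inl h)
    · exact Or.inl (Or.inr h)
    · exact Or.inr h
  obtain ⟨f, hf₁, hf₂, hg⟩ : ∃ f : X → W, (∀ x : X₁, f x = f₁ x) ∧ (∀ x : X₂, f x = f₂ x) ∧
      (∀ y : interior Y, f y = g y) := by
    refine ⟨fun x => if h₁ : x ∈ X₁ then f₁ ⟨x, h₁⟩ else if h₂ : x ∈ X₂ then f₂ ⟨x, h₂⟩ else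
      if hy : x ∈ interior Y then g ⟨x, hy⟩ else hCne.some, ?_, ?_, ?_⟩
    · rintro ⟨x, hx⟩
      simp [hx]
    · rintro ⟨x, hx⟩
      have hx₁ : x ∉ X₁ := fun h => (h12 ▸ ⟨h, hx⟩ : x ∈ (∅ : Set X))
      simp [hx, hx₁]
    · rintro ⟨x, hx⟩
      have hx₁ : x ∉ X₁ := fun h => (h1Y ▸ ⟨h, hx⟩ : x ∈ (∅ : Set X))
      have hx₂ : x ∉ X₂ := fun h => (h2Y ▸ ⟨h, hx⟩ : x ∈ (∅ : Set X))
      simp [hx, hx₁, hx₂]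
  refine ⟨f, hf₁, hf₂, hg, fun w => ?_, fun w => ?_⟩
  · rcases hWcover.symm ▸ Set.mem_univ w with hw | hw
    · obtain ⟨x, rfl⟩ := hf₁onto w hw
      exact ⟨x, hf₁ x⟩
    · obtain ⟨x, rfl⟩ := hf₂onto w hw
      exact ⟨x, hf₂ x⟩
  have hpre : ∀ T : Set W, f ⁻¹' T =
      (↑) '' (f₁ ⁻¹' T) ∪ (↑) '' (f₂ ⁻¹' T) ∪ (↑) '' (g ⁻¹' T) := by
    intro T
    ext x
    constructor
    · intro hx
      rcases hpart x with h | h | h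
      · exact Or.inl (Or.inl ⟨⟨x, h⟩, by rwa [Set.mem_preimage, ← hf₁], rfl⟩)
      · exact Or.inl (Or.inr ⟨⟨x, h⟩, by rwa [Set.mem_preimage, ← hf₂], rfl⟩)
      · exact Or.inr ⟨⟨x, h⟩, by rwa [Set.mem_preimage, ← hg], rfl⟩
    · rintro ((⟨y, hy, rfl⟩ | ⟨y, hy, rfl⟩) | ⟨y, hy, rfl⟩)
      · rwa [Set.mem_preimage, hf₁]
      · rwa [Set.mem_preimage, hf₂]
      · rwa [Set.mem_preimage, hg]
  rw [hpre {w}, derivedSet_union, derivedSet_union,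
    derivedSet_coe_image_fiber hX₁closed hup₁ hf₁into hf₁d,
    derivedSet_coe_image_fiber hX₂closed hup₂ hf₂into hf₂d]
  apply Set.Subset.antisymm
  · rw [hpre]
    refine Set.union_subset Set.subset_union_left fun x hx => ?_
    have hwC : w ∈ C := by
      obtain ⟨_, y, hy, -⟩ := closure_nonempty_iff.1 ⟨x, derivedSet_subset_closure _ hx⟩
      exact (show g y = w from hy) ▸ hginto y
    have hxY : x ∈ Y := closure_minimal
      ((Subtype.coe_image_subset _ _).trans interior_subset) hYclosed
      (derivedSet_subset_closure _ hx)
    rcases hYsub hxY with h | h | h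
    · exact Or.inr ⟨⟨x, h⟩, hCcluster _ (hginto _) _ hwC, rfl⟩
    · obtain ⟨c, hc, hRc⟩ := hf₁bd ⟨x, hfr₁ h⟩ h
      exact Or.inl (Or.inl ⟨⟨x, hfr₁ h⟩, htrans hRc (hCcluster c hc w hwC), rfl⟩)
    · obtain ⟨c, hc, hRc⟩ := hf₂bd ⟨x, hfr₂ h⟩ h
      exact Or.inl (Or.inr ⟨⟨x, hfr₂ h⟩, htrans hRc (hCcluster c hc w hwC), rfl⟩)
  · rw [hpre]
    refine Set.union_subset_union_right _ ?_
    rintro _ ⟨y, hy, rfl⟩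
    have hwC : w ∈ C := hCmax _ (hginto y) w hy
    exact accPt_coe_image_iff.2 ((hgd w hwC).symm ▸ Set.mem_univ y : y ∈ derivedSet (g ⁻¹' {w}))
end

section
/- (Glueing lemma, case (b)) Let X be a topological space in which every point is locally closed (for every x there is an open U ∋ x with closure({x}) ∩ U = {x}), and suppose X = X₁ ∪ X₂ where X₁, X₂ are disjoint, closed and nonempty. Let (W,R) be a finite transitive frame, W₁, W₂ ⊆ W upward closed (R(W_i) ⊆ W_i) with W = W₁ ∪ W₂, and suppose f_i : X_i → W_i (i = 1,2) are surjective with d_{X_i}(f_i⁻¹(w)) = f_i⁻¹(R⁻¹(w) ∩ W_i) for all w ∈ W_i. Then the map f equal to f₁ on X₁ and f₂ on X₂ is surjective onto W and satisfies d(f⁻¹(w)) = f⁻¹(R⁻¹(w)) for all w ∈ W. -/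
/-- Derived sets commute with preimages along open embeddings. -/
theorem Topology.IsOpenEmbedding.derivedSet_preimage {X Y : Type*} [TopologicalSpace X]
    [TopologicalSpace Y] {e : X → Y} (he : Topology.IsOpenEmbedding e) (A : Set Y) :
    derivedSet (e ⁻¹' A) = e ⁻¹' derivedSet A := by
  ext x
  simp only [Set.mem_preimage, mem_derivedSet, accPt_iff_frequently, ← he.map_nhds_eq,
    Filter.frequently_map, he.injective.ne_iff]

/-- The derived-set condition on the points of an upward closed set `V` containing the range of `g`
extends to all points of the frame. -/
theorem derivedSet_preimage_singleton_of_upward_closed {Y W : Type*} [TopologicalSpace Y]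
    {R : W → W → Prop} {V : Set W} {g : Y → W}
    (hup : ∀ w ∈ V, ∀ v, R w v → v ∈ V) (hinto : ∀ y, g y ∈ V)
    (hd : ∀ w ∈ V, derivedSet (g ⁻¹' {w}) = g ⁻¹' ({v | R v w} ∩ V)) (w : W) :
    derivedSet (g ⁻¹' {w}) = g ⁻¹' {v | R v w} := by
  by_cases hw : w ∈ V
  · rw [hd w hw]
    ext y
    simp [hinto y]
  · have hempty : g ⁻¹' {w} = ∅ :=
      Set.eq_empty_of_forall_notMem fun y hy => hw (Set.mem_singleton_iff.1 hy ▸ hinto y)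
    ext y
    have hR : ¬ R (g y) w := fun h => hw (hup _ (hinto y) _ h)
    simp [hempty, hR, derivedSet, AccPt]

/-- the Glueing lemma, case (b). -/
theorem glueing_lemma_case_b
    {X : Type*} [TopologicalSpace X]
    (hloc : ∀ x : X, ∃ U : Set X, IsOpen U ∧ x ∈ U ∧ closure {x} ∩ U = {x})
    (X₁ X₂ : Set X)
    (hX₁closed : IsClosed X₁) (hX₂closed : IsClosed X₂)
    (hX₁ne : X₁.Nonempty) (hX₂ne : X₂.Nonempty)
    (hdisj : X₁ ∩ X₂ = ∅) (hcover : X₁ ∪ X₂ = Set.univ)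
    {W : Type*} [Finite W] (R : W → W → Prop) (htrans : Transitive R)
    (W₁ W₂ : Set W)
    (hup₁ : ∀ w ∈ W₁, ∀ v, R w v → v ∈ W₁) (hup₂ : ∀ w ∈ W₂, ∀ v, R w v → v ∈ W₂)
    (hWcover : W₁ ∪ W₂ = Set.univ)
    (f₁ : X₁ → W) (f₂ : X₂ → W)
    (hf₁into : ∀ x, f₁ x ∈ W₁) (hf₂into : ∀ x, f₂ x ∈ W₂)
    (hf₁onto : ∀ w ∈ W₁, ∃ x, f₁ x = w) (hf₂onto : ∀ w ∈ W₂, ∃ x, f₂ x = w)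
    (hf₁d : ∀ w ∈ W₁, derivedSet (f₁ ⁻¹' {w}) = f₁ ⁻¹' ({v | R v w} ∩ W₁))
    (hf₂d : ∀ w ∈ W₂, derivedSet (f₂ ⁻¹' {w}) = f₂ ⁻¹' ({v | R v w} ∩ W₂)) :
    ∃ f : X → W,
      (∀ x : X₁, f x = f₁ x) ∧ (∀ x : X₂, f x = f₂ x) ∧
      Function.Surjective f ∧
      (∀ w, derivedSet (f ⁻¹' {w}) = f ⁻¹' {v | R v w}) := by
  classical
  have hcompl : X₁ᶜ = X₂ :=
    (IsCompl.of_eq hdisj hcover).compl_eq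
  have hX₁open : IsOpen X₁ := by
    rw [← compl_compl X₁, hcompl]
    exact hX₂closed.isOpen_compl
  have hX₂open : IsOpen X₂ := hcompl ▸ hX₁closed.isOpen_compl
  have hmem₂ {x : X} (hx : x ∉ X₁) : x ∈ X₂ := hcompl ▸ hx
  obtain ⟨f, h₁, h₂⟩ : ∃ f : X → W, (∀ x : X₁, f x = f₁ x) ∧ ∀ x : X₂, f x = f₂ x := by
    refine ⟨fun x => if hx : x ∈ X₁ then f₁ ⟨x, hx⟩ else f₂ ⟨x, hmem₂ hx⟩,
      fun x => dif_pos x.2, fun x => dif_neg fun hx => ?_⟩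
    exact (hdisj.subset ⟨hx, x.2⟩).elim
  refine ⟨f, h₁, h₂, fun w => ?_, fun w => ?_⟩
  · rcases hWcover.ge (Set.mem_univ w) with hw | hw
    · obtain ⟨x, rfl⟩ := hf₁onto w hw
      exact ⟨x, h₁ x⟩
    · obtain ⟨x, rfl⟩ := hf₂onto w hw
      exact ⟨x, h₂ x⟩
  · have restrict {Y : Set X} (hY : IsOpen Y) {g : Y → W} (hg : ∀ x : Y, f x = g x)
        (hd : derivedSet (g ⁻¹' {w}) = g ⁻¹' {v | R v w}) (x : X) (hx : x ∈ Y) :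
        x ∈ derivedSet (f ⁻¹' {w}) ↔ x ∈ f ⁻¹' {v | R v w} := by
      obtain rfl : f ∘ Subtype.val = g := funext hg
      rw [Set.preimage_comp, Set.preimage_comp,
        hY.isOpenEmbedding_subtypeVal.derivedSet_preimage] at hd
      exact Set.ext_iff.1 hd ⟨x, hx⟩
    ext x
    by_cases hx : x ∈ X₁
    · exact restrict hX₁open h₁
        (derivedSet_preimage_singleton_of_upward_closed hup₁ hf₁into hf₁d w) x hx
    · exact restrict hX₂open h₂
        (derivedSet_preimage_singleton_of_upward_closed hup₂ hf₂into hf₂d w) x (hmem₂ hx)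
end

section
/- Suppose a topological space X is the union of a family {X_i}_{i∈I} of pairwise disjoint open subspaces, (W,R) is a transitive frame, W = ⋃_{i∈I} W_i where each W_i is upward closed (R(W_i) ⊆ W_i), and for each i the map f_i : X_i → W_i is a d-morphism onto the restricted frame (W_i, R restricted to W_i) (with X_i carrying the subspace topology). Then the union map f : X → W, equal to f_i on each X_i, is a d-morphism onto (W,R). -/
/-- A d-morphism from a topological space onto a transitive Kripke frame `(W, R)`:
a surjective map which is continuous and open (w.r.t. the Alexandrov topology of
the reflexive closure of `R`), r-dense and i-discrete. -/
def IsDMorphism {X : Type*} [TopologicalSpace X] {W : Type*}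
    (R : W → W → Prop) (f : X → W) : Prop :=
  Function.Surjective f ∧
  (∀ x : X, ∃ U : Set X, IsOpen U ∧ x ∈ U ∧ ∀ y ∈ U, f y = f x ∨ R (f x) (f y)) ∧
  (∀ U : Set X, IsOpen U → ∀ x ∈ U, ∀ w, R (f x) w → ∃ z ∈ U, f z = w) ∧
  (∀ w, R w w → f ⁻¹' {w} ⊆ derivedSet (f ⁻¹' {w})) ∧
  (∀ w, ¬ R w w → f ⁻¹' {w} ∩ derivedSet (f ⁻¹' {w}) = ∅)

/-- Limit points are computed locally: the derived set pulls back along open embeddings. -/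
theorem Topology.IsOpenEmbedding.preimage_derivedSet {X Y : Type*} [TopologicalSpace X]
    [TopologicalSpace Y] {g : X → Y} (hg : Topology.IsOpenEmbedding g) (A : Set Y) :
    g ⁻¹' derivedSet A = derivedSet (g ⁻¹' A) := by
  ext x
  rw [Set.mem_preimage, mem_derivedSet, mem_derivedSet, ← hg.accPt_comap_iff,
    Filter.comap_principal]

/-- the union of d-morphisms defined on pairwise disjoint open
subspaces covering `X`, onto generated subframes covering `(W, R)`, is a
d-morphism onto `(W, R)`. -/
theorem union_of_dMorphisms
    {X : Type*} [TopologicalSpace X] {W : Type*}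
    (R : W → W → Prop) (htrans : Transitive R)
    {I : Type*} (Xs : I → Set X) (Ws : I → Set W)
    (hXopen : ∀ i, IsOpen (Xs i)) (hXdisj : Pairwise (Function.onFun Disjoint Xs))
    (hXcover : ⋃ i, Xs i = Set.univ)
    (hWup : ∀ i, ∀ w ∈ Ws i, ∀ v, R w v → v ∈ Ws i)
    (hWcover : ⋃ i, Ws i = Set.univ)
    (fi : ∀ i, (Xs i) → (Ws i))
    (hfi : ∀ i, IsDMorphism (fun a b : Ws i => R a b) (fi i)) :
    ∃ f : X → W,
      (∀ i, ∀ x : Xs i, f x = (fi i x : W)) ∧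
      IsDMorphism R f := by
  have hcompat : ∀ i j (x : X) (hi : x ∈ Xs i) (hj : x ∈ Xs j),
      (fi i ⟨x, hi⟩ : W) = fi j ⟨x, hj⟩ := by
    intro i j x hi hj
    obtain rfl : i = j := by
      by_contra hij
      exact Set.disjoint_left.mp (hXdisj hij) hi hj
    rfl
  obtain ⟨f, hf⟩ : ∃ f : X → W, ∀ i, ∀ x : Xs i, f x = (fi i x : W) :=
    ⟨Set.liftCover Xs (fun i x => (fi i x : W)) hcompat hXcover,
      fun _ x => Set.liftCover_coe x⟩
  have hcov : ∀ x, ∃ i, x ∈ Xs i := Set.iUnion_eq_univ_iff.mp hXcover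
  have hfibre : ∀ i (w : Ws i),
      (Subtype.val : Xs i → X) ⁻¹' (f ⁻¹' {(w : W)}) = fi i ⁻¹' {w} := by
    intro i w
    ext x
    simp [hf, Subtype.ext_iff]
  have hderived : ∀ i (x : Xs i),
      (x : X) ∈ derivedSet (f ⁻¹' {(fi i x : W)}) ↔ x ∈ derivedSet (fi i ⁻¹' {fi i x}) := by
    intro i x
    rw [← hfibre, ← (hXopen i).isOpenEmbedding_subtypeVal.preimage_derivedSet, Set.mem_preimage]
  refine ⟨f, hf, ?_, ?_, ?_, ?_, ?_⟩
  · intro w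
    obtain ⟨i, hi⟩ := Set.iUnion_eq_univ_iff.mp hWcover w
    obtain ⟨x, hx⟩ := (hfi i).1 ⟨w, hi⟩
    exact ⟨x, by rw [hf, hx]⟩
  · intro x
    obtain ⟨i, hi⟩ := hcov x
    obtain ⟨U, hU, hxU, h⟩ := (hfi i).2.1 ⟨x, hi⟩
    refine ⟨Subtype.val '' U, (hXopen i).isOpenMap_subtype_val U hU, ⟨_, hxU, rfl⟩, ?_⟩
    rintro _ ⟨y, hy, rfl⟩
    rw [hf i y, hf i ⟨x, hi⟩]
    exact (h y hy).imp_left (congrArg Subtype.val)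
  · intro U hU x hxU w hw
    obtain ⟨i, hi⟩ := hcov x
    rw [hf i ⟨x, hi⟩] at hw
    obtain ⟨z, hzU, hz⟩ := (hfi i).2.2.1 (Subtype.val ⁻¹' U) (hU.preimage continuous_subtype_val)
      ⟨x, hi⟩ hxU ⟨w, hWup i _ (fi i ⟨x, hi⟩).2 w hw⟩ hw
    exact ⟨z, hzU, by rw [hf, hz]⟩
  · rintro w hw x rfl
    obtain ⟨i, hi⟩ := hcov x
    rw [hf i ⟨x, hi⟩] at hw ⊢
    exact (hderived i ⟨x, hi⟩).mpr ((hfi i).2.2.2.1 _ hw rfl)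
  · intro w hw
    rw [Set.eq_empty_iff_forall_notMem]
    rintro x ⟨rfl, hx⟩
    obtain ⟨i, hi⟩ := hcov x
    rw [hf i ⟨x, hi⟩] at hw hx
    exact Set.eq_empty_iff_forall_notMem.mp ((hfi i).2.2.2.2 _ hw) ⟨x, hi⟩
      ⟨rfl, (hderived i ⟨x, hi⟩).mp hx⟩
end

section
/- Let l ≥ 1 and let Ψ_l be the finite frame with points b, a₀,…,a_{l−1} and relation R given by: b R a_i and a_i R a_i for all i < l, with no other pairs related (an irreflexive root b below l reflexive maximal points). Let X be a zero-dimensional dense-in-itself metric space and y ∈ X. Then there exists a surjective f : X → Ψ_l such that f⁻¹(b) = {y}, d(f⁻¹(b)) = ∅, and for every i < l, d(f⁻¹(a_i)) = {y} ∪ f⁻¹(a_i) (i.e. d(f⁻¹(w)) = f⁻¹(R⁻¹(w)) for every w ∈ Ψ_l); moreover for every i < l there is a family of pairwise disjoint nonempty open sets whose union is f⁻¹(a_i) and which is dense at y. -/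
open TopologicalSpace

/-- The complement of a point `y` in a zero-dimensional dense-in-itself metric space splits into a
sequence of disjoint nonempty open sets converging to `y`. -/
theorem exists_seq_isOpen_disjoint_iUnion_eq_compl_singleton
    {X : Type*} [MetricSpace X] [PerfectSpace X]
    (hzd : IsTopologicalBasis {s : Set X | IsClopen s}) (y : X) :
    ∃ C : ℕ → Set X, (∀ n, IsOpen (C n)) ∧ (∀ n, (C n).Nonempty) ∧
      Pairwise (Function.onFun Disjoint C) ∧ (⋃ n, C n) = {y}ᶜ ∧
      ∀ V ∈ nhds y, ∃ N, ∀ n ≥ N, C n ⊆ V := by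
  have step : ∀ (n : ℕ) (U : {s : Set X // IsClopen s ∧ y ∈ s}),
      ∃ T : {s : Set X // IsClopen s ∧ y ∈ s},
        T.1 ⊂ U.1 ∧ T.1 ⊆ Metric.ball y (1 / ((n : ℝ) + 1)) := by
    rintro n ⟨U, hU, hyU⟩
    have hyacc : AccPt y (Filter.principal Set.univ) := PerfectSpace.univ_preperfect y trivial
    obtain ⟨z, ⟨hzU, -⟩, hzy⟩ := accPt_iff_nhds.mp hyacc U (hU.isOpen.mem_nhds hyU)
    have hW : U ∩ Metric.ball y (1 / ((n : ℝ) + 1)) ∩ {z}ᶜ ∈ nhds y :=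
      Filter.inter_mem (Filter.inter_mem (hU.isOpen.mem_nhds hyU)
        (Metric.ball_mem_nhds y (by positivity)))
        (isOpen_compl_singleton.mem_nhds fun h => hzy h.symm)
    obtain ⟨T, hT, hyT, hsub⟩ := hzd.mem_nhds_iff.mp hW
    refine ⟨⟨T, hT, hyT⟩, ⟨fun x hx => (hsub hx).1.1, fun h => ?_⟩, fun x hx => (hsub hx).1.2⟩
    exact (hsub (h hzU)).2 rfl
  choose g hg_ssub hg_ball using step
  let U : ℕ → {s : Set X // IsClopen s ∧ y ∈ s} :=
    fun n => Nat.rec ⟨Set.univ, isClopen_univ, trivial⟩ g n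
  have hU_ssub : ∀ n, (U (n + 1)).1 ⊂ (U n).1 := fun n => hg_ssub n (U n)
  have hU_ball : ∀ n : ℕ, (U (n + 1)).1 ⊆ Metric.ball y (1 / ((n : ℝ) + 1)) :=
    fun n => hg_ball n (U n)
  have hU_anti : Antitone fun n => (U n).1 := antitone_nat_of_succ_le fun n => (hU_ssub n).1
  have hU_small : ∀ V ∈ nhds y, ∃ N, (U N).1 ⊆ V := by
    intro V hV
    obtain ⟨ε, hε, hεV⟩ := Metric.mem_nhds_iff.mp hV
    obtain ⟨n, hn⟩ := exists_nat_one_div_lt hε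
    exact ⟨n + 1, (hU_ball n).trans ((Metric.ball_subset_ball hn.le).trans hεV)⟩
  refine ⟨fun n => (U n).1 \ (U (n + 1)).1, fun n => ((U n).2.1.diff (U (n + 1)).2.1).isOpen,
    fun n => Set.nonempty_of_ssubset (hU_ssub n), ?_, ?_, ?_⟩
  · refine (pairwise_disjoint_on _).mpr fun m n hmn => Set.disjoint_left.mpr fun x hm hn => ?_
    exact hm.2 (hU_anti (Nat.succ_le_of_lt hmn) hn.1)
  · ext x
    simp only [Set.mem_iUnion, Set.mem_compl_iff, Set.mem_singleton_iff]
    constructor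
    · rintro ⟨n, -, hn⟩ rfl
      exact hn (U (n + 1)).2.2
    · intro hx
      by_contra! hC
      have hall : ∀ n, x ∈ (U n).1 := fun n => by
        induction n with
        | zero => trivial
        | succ n ih => exact not_not.mp fun h => hC n ⟨ih, h⟩
      obtain ⟨N, hN⟩ := hU_small {x}ᶜ (isOpen_compl_singleton.mem_nhds fun h => hx h.symm)
      exact hN (hall N) rfl
  · intro V hV
    obtain ⟨N, hN⟩ := hU_small V hV
    exact ⟨N, fun n hn => Set.sdiff_subset.trans ((hU_anti hn).trans hN)⟩

/-- every zero-dimensional dense-in-itself metric space admits a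
d-morphism onto the frame `Ψ_l` (an irreflexive root `b = none` below `l`
reflexive maximal points `aᵢ = some i`), with the preimage of the root equal to
a prescribed singleton `{y}`, and with each `f⁻¹(aᵢ)` a union of a family of
disjoint nonempty open sets dense at `y`. -/
theorem dMorphism_onto_Psi_l
    {X : Type*} [MetricSpace X] [PerfectSpace X]
    (hzd : IsTopologicalBasis {s : Set X | IsClopen s})
    (l : ℕ) (hl : 1 ≤ l) (y : X) :
    ∃ f : X → Option (Fin l), Function.Surjective f ∧
      f ⁻¹' {none} = {y} ∧
      derivedSet (f ⁻¹' {none}) = ∅ ∧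
      (∀ i : Fin l, derivedSet (f ⁻¹' {some i}) = {y} ∪ f ⁻¹' {some i}) ∧
      (∀ i : Fin l, ∃ α : Set (Set X),
        (∀ U ∈ α, IsOpen U ∧ U.Nonempty) ∧
        α.Pairwise Disjoint ∧
        ⋃₀ α = f ⁻¹' {some i} ∧
        (∀ V ∈ nhds y, ∃ U ∈ α, U ⊆ V)) := by
  classical
  obtain ⟨C, hC_open, hC_ne, hC_disj, hC_union, hC_small⟩ :=
    exists_seq_isOpen_disjoint_iUnion_eq_compl_singleton hzd y
  have hC_iff : ∀ x, (∃ n, x ∈ C n) ↔ x ≠ y := fun x => by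
    rw [← Set.mem_iUnion, hC_union, Set.mem_compl_singleton_iff]
  let r : ℕ → Fin l := fun n => ⟨n % l, Nat.mod_lt n hl⟩
  let f : X → Option (Fin l) := fun x => if h : ∃ n, x ∈ C n then some (r h.choose) else none
  have hf_mem : ∀ n, ∀ x ∈ C n, f x = some (r n) := by
    intro n x hx
    have h : ∃ n, x ∈ C n := ⟨n, hx⟩
    have hn : h.choose = n := by
      by_contra hne
      exact Set.disjoint_left.mp (hC_disj hne) h.choose_spec hx
    simp only [f, dif_pos h, hn]
  have hf_none : f ⁻¹' {none} = {y} := by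
    ext x
    by_cases h : ∃ n, x ∈ C n
    · simp [f, h, (hC_iff x).mp h]
    · have hxy : x = y := not_not.mp (mt (hC_iff x).mpr h)
      exact iff_of_true (dif_neg h) hxy
  have hf_some : ∀ i, f ⁻¹' {some i} = ⋃₀ (C '' {n | r n = i}) := by
    intro i
    ext x
    simp only [Set.mem_preimage, Set.mem_singleton_iff, Set.sUnion_image, Set.mem_iUnion,
      Set.mem_ofPred_eq, exists_prop]
    constructor
    · intro hx
      have h : ∃ n, x ∈ C n := by
        by_contra h
        simp [f, h] at hx
      obtain ⟨n, hn⟩ := h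
      exact ⟨n, Option.some_injective _ ((hf_mem n x hn).symm.trans hx), hn⟩
    · rintro ⟨n, rfl, hn⟩
      exact hf_mem n x hn
  have hf_open : ∀ i, IsOpen (f ⁻¹' {some i}) := fun i => by
    rw [hf_some]
    exact isOpen_sUnion (Set.forall_mem_image.mpr fun n _ => hC_open n)
  have hC_dense : ∀ i, ∀ V ∈ nhds y, ∃ n, r n = i ∧ C n ⊆ V := by
    intro i V hV
    obtain ⟨N, hN⟩ := hC_small V hV
    refine ⟨i + l * N, Fin.ext ?_, hN _ ?_⟩
    · simp [r, Nat.mod_eq_of_lt i.2]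
    · exact (Nat.le_mul_of_pos_left N hl).trans (Nat.le_add_left _ _)
  refine ⟨f, ?_, hf_none, ?_, ?_, ?_⟩
  · rintro (_ | i)
    · exact ⟨y, hf_none.symm.subset rfl⟩
    · obtain ⟨n, rfl, -⟩ := hC_dense i Set.univ Filter.univ_mem
      obtain ⟨x, hx⟩ := hC_ne n
      exact ⟨x, hf_mem n x hx⟩
  · rw [hf_none, Set.eq_empty_iff_forall_notMem]
    intro x hx
    obtain ⟨z, ⟨-, rfl⟩, hzx⟩ := accPt_iff_nhds.mp hx Set.univ Filter.univ_mem
    obtain ⟨w, ⟨hw, rfl⟩, -⟩ := accPt_iff_nhds.mp hx {z}ᶜ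
      (isOpen_compl_singleton.mem_nhds fun h => hzx h.symm)
    exact hw rfl
  · intro i
    ext x
    constructor
    · intro hx
      rcases hfx : f x with _ | j
      · exact Or.inl (hf_none.subset hfx)
      · obtain ⟨z, ⟨hzj, hzi⟩, -⟩ := accPt_iff_nhds.mp hx _ ((hf_open j).mem_nhds hfx)
        have hij : some j = some i := hzj.symm.trans hzi
        exact Or.inr (hfx.trans hij)
    · rintro (rfl | hx)
      · refine accPt_iff_nhds.mpr fun V hV => ?_
        obtain ⟨n, rfl, hnV⟩ := hC_dense i V hV
        obtain ⟨z, hz⟩ := hC_ne n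
        exact ⟨z, ⟨hnV hz, hf_mem n z hz⟩, (hC_iff z).mp ⟨n, hz⟩⟩
      · have hacc : AccPt x (Filter.principal Set.univ) := PerfectSpace.univ_preperfect x trivial
        refine accPt_iff_nhds.mpr fun V hV => ?_
        obtain ⟨z, ⟨hz, -⟩, hzx⟩ := accPt_iff_nhds.mp hacc _
          (Filter.inter_mem hV ((hf_open i).mem_nhds hx))
        exact ⟨z, hz, hzx⟩
  · intro i
    refine ⟨C '' {n | r n = i}, ?_, ?_, (hf_some i).symm, ?_⟩
    · exact Set.forall_mem_image.mpr fun n _ => ⟨hC_open n, hC_ne n⟩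
    · rintro _ ⟨m, -, rfl⟩ _ ⟨n, -, rfl⟩ hmn
      exact hC_disj (ne_of_apply_ne C hmn)
    · intro V hV
      obtain ⟨n, hn, hnV⟩ := hC_dense i V hV
      exact ⟨C n, ⟨n, hn, rfl⟩, hnV⟩
end

section
/- Let X be a zero-dimensional dense-in-itself separable metric space and (W,R) a finite rooted D4-frame: W finite nonempty, R transitive and serial, and there is a root r with w = r or r R w for every w ∈ W. Then there exists a surjective f : X → W with d(f⁻¹(w)) = f⁻¹(R⁻¹(w)) for every w ∈ W; moreover, if the root r is irreflexive (¬ r R r), then f⁻¹(r) is a singleton. -/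
open TopologicalSpace
open Set Filter Topology

namespace DMorphism

variable {X W : Type*} [TopologicalSpace X] {R : W → W → Prop} {U : Set X} {x₀ : X} {r : W}

/-- The d-morphism condition at a single point: punctured neighbourhoods of `x` are eventually
mapped into the successors of `f x`, and every successor is attained arbitrarily close to `x`. -/
def IsDMorphismAt (R : W → W → Prop) (f : X → W) (x : X) : Prop :=
  (∀ᶠ y in 𝓝[≠] x, R (f x) (f y)) ∧ ∀ v, R (f x) v → ∃ᶠ y in 𝓝[≠] x, f y = v

theorem IsDMorphismAt.congr {f g : X → W} {x : X} (hf : IsDMorphismAt R f x)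
    (h : f =ᶠ[𝓝 x] g) : IsDMorphismAt R g x := by
  have hx : f x = g x := h.self_of_nhds
  have h' : f =ᶠ[𝓝[≠] x] g := h.filter_mono nhdsWithin_le_nhds
  refine ⟨?_, fun v hv => ?_⟩
  · filter_upwards [hf.1, h'] with y hy hfg
    rwa [← hx, ← hfg]
  · refine ((hf.2 v (hx ▸ hv)).and_eventually h').mono ?_
    rintro y ⟨hy, hfg⟩
    rw [← hfg, hy]

theorem IsDMorphismAt.congr_of_eqOn {f g : X → W} {x : X} {V : Set X} (hf : IsDMorphismAt R f x)
    (hV : IsOpen V) (hx : x ∈ V) (h : EqOn f g V) : IsDMorphismAt R g x :=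
  hf.congr (eventually_of_mem (hV.mem_nhds hx) h)

theorem derivedSet_preimage_singleton {f : X → W} (hf : ∀ x, IsDMorphismAt R f x) (w : W) :
    derivedSet (f ⁻¹' {w}) = f ⁻¹' {v | R v w} := by
  ext x
  rw [mem_derivedSet, accPt_iff_frequently_nhdsNE]
  refine ⟨fun h => ?_, fun h => (hf x).2 w h⟩
  obtain ⟨y, hy, hR⟩ := (h.and_eventually (hf x).1).exists
  have hy : f y = w := hy
  exact hy ▸ hR

/-- `f` restricts on `U` to a d-morphism onto the subframe generated by `w`, and attains `w` only
once if `w` is irreflexive. -/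
def IsDMorphismOnto (R : W → W → Prop) (w : W) (U : Set X) (f : X → W) : Prop :=
  (∀ x ∈ U, IsDMorphismAt R f x) ∧ (∀ x ∈ U, f x = w ∨ R w (f x)) ∧
    ∃ x ∈ U, f x = w ∧ (¬ R w w → ∀ y ∈ U, f y = w → y = x)

/-- A partial approximation to a d-morphism onto the subframe generated by `r`: the map
`toFun` is regarded as decided on the clopen set `upper`, where its values are successors of
`r`, and on the finite set `bottom`, where its values belong to the cluster of `r`. -/
structure Approx (R : W → W → Prop) (x₀ : X) (r : W) where
  /-- The clopen set on which the map is decided. -/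
  upper : Set X
  /-- The finite set of points decided to lie over the cluster of the root. -/
  bottom : Set X
  /-- The map, relevant only on `upper ∪ bottom`. -/
  toFun : X → W
  isClopen_upper : IsClopen upper
  finite_bottom : bottom.Finite
  disjoint : Disjoint upper bottom
  isDMorphismAt : ∀ x ∈ upper, IsDMorphismAt R toFun x
  rel_upper : ∀ x ∈ upper, R r (toFun x)
  cluster_bottom : ∀ x ∈ bottom, toFun x = r ∨ (R r (toFun x) ∧ R (toFun x) r)
  mem_bottom : x₀ ∈ bottom
  toFun_root : toFun x₀ = r
  bottom_subset : ¬ R r r → bottom ⊆ {x₀}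

namespace Approx

/-- The set on which an approximation is decided. -/
def dom (c : Approx R x₀ r) : Set X := c.upper ∪ c.bottom

instance : Preorder (Approx R x₀ r) where
  le c d := c.upper ⊆ d.upper ∧ c.bottom ⊆ d.bottom ∧ EqOn c.toFun d.toFun c.dom
  le_refl c := ⟨Subset.rfl, Subset.rfl, fun _ _ => rfl⟩
  le_trans a b c h k := ⟨h.1.trans k.1, h.2.1.trans k.2.1,
    fun _ hx => (h.2.2 hx).trans (k.2.2 (union_subset_union h.1 h.2.1 hx))⟩

theorem dom_mono {c d : Approx R x₀ r} (h : c ≤ d) : c.dom ⊆ d.dom :=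
  union_subset_union h.1 h.2.1

theorem exists_decide_point (c : Approx R x₀ r) {x : X} {v : W} (hx : x ∉ c.dom)
    (hrv : R r v) (hvr : R v r) (hrr : R r r) :
    ∃ d, c ≤ d ∧ d.upper = c.upper ∧ x ∈ d.dom ∧ d.toFun x = v := by
  classical
  have hne : ∀ y ∈ c.dom, Function.update c.toFun x v y = c.toFun y := fun y hy =>
    Function.update_of_ne (ne_of_mem_of_not_mem hy hx) _ _
  refine ⟨⟨c.upper, insert x c.bottom, Function.update c.toFun x v, c.isClopen_upper,
    c.finite_bottom.insert x, ?_, ?_, ?_, ?_, mem_insert_of_mem _ c.mem_bottom, ?_,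
    fun h => absurd hrr h⟩, ⟨Subset.rfl, subset_insert _ _, fun y hy => (hne y hy).symm⟩, rfl,
    Or.inr (mem_insert _ _), Function.update_self x v c.toFun⟩
  · exact disjoint_insert_right.2 ⟨fun h => hx (Or.inl h), c.disjoint⟩
  · exact fun y hy => (c.isDMorphismAt y hy).congr_of_eqOn c.isClopen_upper.isOpen hy
      fun z hz => (hne z (Or.inl hz)).symm
  · intro y hy
    rw [hne y (Or.inl hy)]
    exact c.rel_upper y hy
  · rintro y (rfl | hy)
    · rw [Function.update_self]
      exact Or.inr ⟨hrv, hvr⟩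
    · rw [hne y (Or.inr hy)]
      exact c.cluster_bottom y hy
  · rw [hne _ (Or.inr c.mem_bottom), c.toFun_root]

theorem exists_decide_clopen (htrans : Transitive R) (c : Approx R x₀ r) {N : Set X}
    (hN : IsClopen N) (hNc : Disjoint N c.dom) {v : W} (hrv : R r v) {g : X → W}
    (hg : IsDMorphismOnto R v N g) :
    ∃ d, c ≤ d ∧ d.upper = c.upper ∪ N ∧ ∃ x ∈ N, d.toFun x = v := by
  classical
  have hgN : EqOn g (N.piecewise g c.toFun) N := fun y hy => (piecewise_eq_of_mem _ _ _ hy).symm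
  have hcN : EqOn c.toFun (N.piecewise g c.toFun) c.dom := fun y hy =>
    (piecewise_eq_of_notMem _ _ _ (disjoint_right.1 hNc hy)).symm
  obtain ⟨hg₁, hg₂, x, hxN, hxv, -⟩ := hg
  refine ⟨⟨c.upper ∪ N, c.bottom, N.piecewise g c.toFun, c.isClopen_upper.union hN,
    c.finite_bottom, ?_, ?_, ?_, ?_, c.mem_bottom, ?_, c.bottom_subset⟩,
    ⟨subset_union_left, Subset.rfl, hcN⟩, rfl, x, hxN, ?_⟩
  · exact disjoint_union_left.2 ⟨c.disjoint, hNc.mono_right subset_union_right⟩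
  · rintro y (hy | hy)
    · exact (c.isDMorphismAt y hy).congr_of_eqOn c.isClopen_upper.isOpen hy
        (hcN.mono subset_union_left)
    · exact (hg₁ y hy).congr_of_eqOn hN.isOpen hy hgN
  · rintro y (hy | hy)
    · rw [← hcN (Or.inl hy)]
      exact c.rel_upper y hy
    · rw [← hgN hy]
      rcases hg₂ y hy with h | h
      · rwa [h]
      · exact htrans hrv h
  · intro y hy
    rw [← hcN (Or.inr hy)]
    exact c.cluster_bottom y hy
  · rw [← hcN (Or.inr c.mem_bottom), c.toFun_root]
  · exact (hgN hxN).symm.trans hxv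

/-- If `B` is not yet decided, then a new point of `B` can be given any prescribed value `v` above
the root while keeping `B` undecided. -/
theorem exists_new_point [T1Space X] [PerfectSpace X]
    (hzd : IsTopologicalBasis {s : Set X | IsClopen s})
    (htrans : Transitive R)
    (ih : ∀ v, R r v → ¬ R v r → ∀ N : Set X, IsClopen N → N.Nonempty →
      ∃ g, IsDMorphismOnto R v N g)
    (c : Approx R x₀ r) {B : Set X} (hB : IsOpen B) (hBc : (B \ c.upper).Nonempty)
    {v : W} (hrv : R r v) :
    ∃ d, c ≤ d ∧ (B \ d.upper).Nonempty ∧ ∃ x ∈ B, x ∉ c.dom ∧ x ∈ d.dom ∧ d.toFun x = v := by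
  have hopen : IsOpen (B \ c.upper) := hB.sdiff c.isClopen_upper.isClosed
  obtain ⟨z, hz⟩ := hBc
  have hinf : ((B \ c.upper) \ c.bottom).Infinite :=
    (infinite_of_mem_nhds z (hopen.mem_nhds hz)).sdiff c.finite_bottom
  obtain ⟨x, hx, y, hy, hxy⟩ := hinf.nontrivial
  have hxc : x ∉ c.dom := fun h => h.elim hx.1.2 hx.2
  by_cases hvr : R v r
  · obtain ⟨d, hcd, hd, hxd, hdv⟩ := c.exists_decide_point hxc hrv hvr (htrans hrv hvr)
    exact ⟨d, hcd, ⟨z, hd ▸ hz⟩, x, hx.1.1, hxc, hxd, hdv⟩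
  · have hA : IsOpen (((B \ c.upper) \ c.bottom) \ {y}) :=
      (hopen.sdiff c.finite_bottom.isClosed).sdiff isClosed_singleton
    obtain ⟨N, hN, hxN, hNA⟩ := hzd.exists_subset_of_mem_open (mem_sdiff_of_mem hx hxy) hA
    obtain ⟨g, hg⟩ := ih v hrv hvr N hN ⟨x, hxN⟩
    have hNc : Disjoint N c.dom := disjoint_left.2 fun a ha h =>
      h.elim (hNA ha).1.1.2 (hNA ha).1.2
    obtain ⟨d, hcd, hd, x', hx', hdv⟩ := c.exists_decide_clopen htrans hN hNc hrv hg
    refine ⟨d, hcd, ⟨y, hy.1.1, ?_⟩, x', (hNA hx').1.1.1, disjoint_left.1 hNc hx',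
      Or.inl (hd ▸ Or.inr hx'), hdv⟩
    rw [hd]
    exact fun h => h.elim hy.1.2 fun h => (hNA h).2 rfl

/-- The requirement that the basic set `B` is either decided within `U`, or carries two points of
value `v`; the latter is only allowed at `x₀` if the root is irreflexive. -/
def Meets (c : Approx R x₀ r) (U B : Set X) (v : W) : Prop :=
  R r v → B ∩ U ⊆ c.upper ∨ ((R r r ∨ x₀ ∈ B) ∧
    ∃ x ∈ B ∩ c.dom, ∃ y ∈ B ∩ c.dom, x ≠ y ∧ c.toFun x = v ∧ c.toFun y = v)

theorem isCofinal_meets [T1Space X] [PerfectSpace X]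
    (hzd : IsTopologicalBasis {s : Set X | IsClopen s})
    (htrans : Transitive R) (hU : IsClopen U)
    (ih : ∀ v, R r v → ¬ R v r → ∀ N : Set X, IsClopen N → N.Nonempty →
      ∃ g, IsDMorphismOnto R v N g)
    {B : Set X} (hB : IsClopen B) (v : W) :
    IsCofinal {c : Approx R x₀ r | c.Meets U B v} := by
  intro c
  by_cases hrv : R r v
  swap
  · exact ⟨c, fun h => absurd h hrv, le_rfl⟩
  by_cases hBc : B ∩ U ⊆ c.upper
  · exact ⟨c, fun _ => Or.inl hBc, le_rfl⟩
  have hne : ((B ∩ U) \ c.upper).Nonempty := sdiff_nonempty.2 hBc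
  by_cases hr : R r r ∨ x₀ ∈ B
  · obtain ⟨d, hcd, hd, x, hxB, hxc, hxd, hxv⟩ :=
      c.exists_new_point hzd htrans ih (hB.inter hU).isOpen hne hrv
    obtain ⟨e, hde, he, y, hyB, hyd, hye, hyv⟩ :=
      d.exists_new_point hzd htrans ih (hB.inter hU).isOpen hd hrv
    refine ⟨e, fun _ => Or.inr ⟨hr, x, ⟨hxB.1, dom_mono hde hxd⟩, y, ⟨hyB.1, hye⟩, ?_, ?_, hyv⟩,
      hcd.trans hde⟩
    · rintro rfl
      exact hyd hxd
    · rw [← hde.2.2 hxd, hxv]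
  · push Not at hr
    have hvr : ¬ R v r := fun h => hr.1 (htrans hrv h)
    have hN : IsClopen ((B ∩ U) \ c.upper) := (hB.inter hU).diff c.isClopen_upper
    obtain ⟨g, hg⟩ := ih v hrv hvr _ hN hne
    have hNc : Disjoint ((B ∩ U) \ c.upper) c.dom := disjoint_left.2 fun a ha h =>
      h.elim ha.2 fun h => hr.2 (c.bottom_subset hr.1 h ▸ ha.1.1)
    obtain ⟨d, hcd, hd, -⟩ := c.exists_decide_clopen htrans hN hNc hrv hg
    refine ⟨d, fun _ => Or.inl ?_, hcd⟩
    rw [hd, union_sdiff_self]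
    exact subset_union_right

/-- The map determined by a sequence of approximations, with undecided points sent to the root. -/
noncomputable def limit (c : ℕ → Approx R x₀ r) (x : X) : W :=
  open Classical in if h : ∃ n, x ∈ (c n).dom then (c h.choose).toFun x else r

theorem limit_eq {c : ℕ → Approx R x₀ r} (hc : Monotone c) {n : ℕ} {x : X}
    (hx : x ∈ (c n).dom) : limit c x = (c n).toFun x := by
  have h : ∃ n, x ∈ (c n).dom := ⟨n, hx⟩
  rw [limit, dif_pos h]
  rcases le_total n h.choose with hle | hle
  · exact ((hc hle).2.2 hx).symm
  · exact (hc hle).2.2 h.choose_spec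

theorem isDMorphismOnto_limit [T1Space X] (htrans : Transitive R) (hserial : ∀ w, ∃ v, R w v)
    (hU : IsOpen U) (hx₀ : x₀ ∈ U) {b : Set (Set X)} (hb : IsTopologicalBasis b)
    {c : ℕ → Approx R x₀ r} (hc : Monotone c) (hmeets : ∀ B ∈ b, ∀ v, ∃ n, (c n).Meets U B v) :
    IsDMorphismOnto R r U (limit c) := by
  have hupper : ∀ {n x}, x ∈ (c n).upper → R r (limit c x) := fun {n x} hx => by
    rw [limit_eq hc (Or.inl hx)]
    exact (c n).rel_upper x hx
  have hrest : ∀ {x}, (∀ n, x ∉ (c n).upper) →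
      limit c x = r ∨ (R r (limit c x) ∧ R (limit c x) r) := fun {x} hx => by
    by_cases h : ∃ n, x ∈ (c n).dom
    · obtain ⟨n, hn⟩ := h
      rw [limit_eq hc hn]
      exact (c n).cluster_bottom x (hn.resolve_left (hx n))
    · exact Or.inl (dif_neg h)
  have hpoints : ∀ {x}, x ∈ U → (∀ n, x ∉ (c n).upper) → ∀ {v}, R r v → ∀ B ∈ b, x ∈ B →
      (R r r ∨ x₀ ∈ B) ∧ ∃ y ∈ B, y ≠ x ∧ limit c y = v := by
    intro x hxU hx v hrv B hB hxB
    obtain ⟨n, hn⟩ := hmeets B hB v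
    rcases hn hrv with h | ⟨hr, y, hy, z, hz, hyz, hyv, hzv⟩
    · exact absurd (h ⟨hxB, hxU⟩) (hx n)
    · refine ⟨hr, ?_⟩
      by_cases hyx : y = x
      · exact ⟨z, hz.1, fun h => hyz (hyx.trans h.symm), (limit_eq hc hz.2).trans hzv⟩
      · exact ⟨y, hy.1, hyx, (limit_eq hc hy.2).trans hyv⟩
  have huniq : ¬ R r r → ∀ x ∈ U, (∀ n, x ∉ (c n).upper) → x = x₀ := by
    intro hr x hxU hx
    by_contra hne
    obtain ⟨v, hv⟩ := hserial r
    obtain ⟨B, hB, hxB, hBsub⟩ := hb.exists_subset_of_mem_open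
      (show x ∈ ({x₀} : Set X)ᶜ from hne) isOpen_compl_singleton
    exact (hpoints hxU hx hv B hB hxB).1.elim hr fun h => hBsub h rfl
  refine ⟨fun x hxU => ?_, fun x _ => ?_, x₀, hx₀, ?_, fun hr y hy hyr => ?_⟩
  · by_cases h : ∃ n, x ∈ (c n).upper
    · obtain ⟨n, hn⟩ := h
      exact ((c n).isDMorphismAt x hn).congr_of_eqOn (c n).isClopen_upper.isOpen hn
        fun y hy => (limit_eq hc (Or.inl hy)).symm
    push Not at h
    refine ⟨?_, fun v hv => ?_⟩
    · filter_upwards [mem_nhdsWithin_of_mem_nhds (hU.mem_nhds hxU), self_mem_nhdsWithin]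
        with y hyU hyx
      have hry : R r (limit c y) := by
        by_cases hy : ∃ n, y ∈ (c n).upper
        · exact hupper hy.choose_spec
        push Not at hy
        by_cases hr : R r r
        · rcases hrest hy with h' | h'
          · rwa [h']
          · exact h'.1
        · exact absurd ((huniq hr y hyU hy).trans (huniq hr x hxU h).symm) hyx
      rcases hrest h with h' | h'
      · rwa [h']
      · exact htrans h'.2 hry
    · have hrv : R r v := by
        rcases hrest h with h' | h'
        · rwa [← h']
        · exact htrans h'.1 hv
      rw [frequently_nhdsWithin_iff, hb.nhds_hasBasis.frequently_iff]
      rintro B ⟨hB, hxB⟩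
      obtain ⟨y, hyB, hyx, hyv⟩ := (hpoints hxU h hrv B hB hxB).2
      exact ⟨y, hyB, hyv, hyx⟩
  · by_cases h : ∃ n, x ∈ (c n).upper
    · exact Or.inr (hupper h.choose_spec)
    · push Not at h
      exact (hrest h).imp_right And.left
  · rw [limit_eq hc (n := 0) (Or.inr (c 0).mem_bottom), (c 0).toFun_root]
  · exact huniq hr y hy fun n hn => hr (by simpa only [hyr] using hupper hn)

end Approx

theorem exists_isDMorphismOnto [T1Space X] [PerfectSpace X] [SecondCountableTopology X]
    (hzd : IsTopologicalBasis {s : Set X | IsClopen s}) [Finite W]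
    (htrans : Transitive R) (hserial : ∀ w, ∃ v, R w v) (w : W) :
    ∀ U : Set X, IsClopen U → U.Nonempty → ∃ f, IsDMorphismOnto R w U f := by
  let S : W → W → Prop := fun v w => R w v ∧ ¬ R v w
  have : IsTrans W S := ⟨fun a b c hab hbc =>
    ⟨htrans hbc.1 hab.1, fun h => hab.2 (htrans h hbc.1)⟩⟩
  have : Std.Irrefl S := ⟨fun a h => h.2 h.1⟩
  induction w using (Finite.wellFounded_of_trans_of_irrefl S).induction with
  | _ r ih =>
  rintro U hU ⟨x₀, hx₀⟩
  obtain ⟨b, hbsub, hbc, hb⟩ := hzd.exists_countable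
  have : Countable b := hbc.to_subtype
  let : Encodable (b × W) := Encodable.ofCountable _
  let start : Approx R x₀ r :=
    { upper := ∅
      bottom := {x₀}
      toFun := fun _ => r
      isClopen_upper := isClopen_empty
      finite_bottom := finite_singleton _
      disjoint := empty_disjoint _
      isDMorphismAt := fun _ h => h.elim
      rel_upper := fun _ h => h.elim
      cluster_bottom := fun _ _ => Or.inl rfl
      mem_bottom := rfl
      toFun_root := rfl
      bottom_subset := fun _ => Subset.rfl }
  let D : b × W → Order.Cofinal (Approx R x₀ r) := fun p =>
    ⟨_, Approx.isCofinal_meets hzd htrans hU (fun v h h' => ih v ⟨h, h'⟩)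
      (hbsub p.1.2) p.2⟩
  exact ⟨_, Approx.isDMorphismOnto_limit htrans hserial hU.isOpen hx₀ hb
    (Order.sequenceOfCofinals.monotone start D) fun B hB v =>
      ⟨_, Order.sequenceOfCofinals.encode_mem start D (⟨B, hB⟩, v)⟩⟩

end DMorphism

/-- every zero-dimensional dense-in-itself separable metric space
admits a d-morphism onto any finite rooted D4-frame, which moreover is 1-fold
at the root whenever the root is irreflexive. -/
theorem dMorphism_onto_finite_rooted_D4_frame
    {X : Type*} [MetricSpace X] [Nonempty X] [SeparableSpace X] [PerfectSpace X]
    (hzd : IsTopologicalBasis {s : Set X | IsClopen s})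
    {W : Type*} [Finite W] [Nonempty W] (R : W → W → Prop)
    (htrans : Transitive R) (hserial : ∀ w, ∃ v, R w v)
    (r : W) (hroot : ∀ w, w = r ∨ R r w) :
    ∃ f : X → W, Function.Surjective f ∧
      (∀ w, derivedSet (f ⁻¹' {w}) = f ⁻¹' {v | R v w}) ∧
      (¬ R r r → ∃ x : X, f ⁻¹' {r} = {x}) := by
  have : SecondCountableTopology X := UniformSpace.secondCountable_of_separable X
  obtain ⟨f, hf, -, x, -, hxr, huniq⟩ := DMorphism.exists_isDMorphismOnto hzd htrans hserial r
    Set.univ isClopen_univ Set.univ_nonempty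
  have hf : ∀ y, DMorphism.IsDMorphismAt R f y := fun y => hf y (Set.mem_univ y)
  refine ⟨f, fun w => ?_, DMorphism.derivedSet_preimage_singleton hf, fun hr => ⟨x, ?_⟩⟩
  · rcases hroot w with rfl | hw
    · exact ⟨x, hxr⟩
    · exact ((hf x).2 w (hxr ▸ hw)).exists
  · ext y
    refine ⟨fun hy => huniq hr y (Set.mem_univ y) hy, ?_⟩
    rintro rfl
    exact hxr
end

section
/- Let X be a zero-dimensional dense-in-itself separable metric space and (W,R) a finite D4-frame (W finite nonempty, R transitive and serial). Then there exists a surjective f : X → W with d(f⁻¹(w)) = f⁻¹(R⁻¹(w)) for every w ∈ W, such that f⁻¹(w) is a singleton for every strictly R-minimal point w (i.e. every w with R⁻¹(w) = ∅). -/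
open TopologicalSpace

open Set Filter Topology

namespace DMorphism

section Splitting

variable {X : Type*} [MetricSpace X] [PerfectSpace X]

/-- A clopen neighbourhood can be shrunk properly inside any given neighbourhood. -/
lemma exists_clopen_ssubset (hzd : IsTopologicalBasis {s : Set X | IsClopen s})
    {x : X} {V N : Set X} (hV : IsClopen V) (hx : x ∈ V) (hN : N ∈ 𝓝 x) :
    ∃ V' : Set X, IsClopen V' ∧ x ∈ V' ∧ V' ⊆ V ∧ V' ⊆ N ∧ (V \ V').Nonempty := by
  have hVx : V ∈ 𝓝 x := hV.isOpen.mem_nhds hx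
  obtain ⟨y, hyV, hyx⟩ : ∃ y ∈ V, y ≠ x := by
    have h := accPt_iff_nhds.mp (PerfectSpace.univ_preperfect x (mem_univ x)) V hVx
    obtain ⟨y, hy, hne⟩ := h
    exact ⟨y, hy.1, hne⟩
  obtain ⟨V', hV', hxV', hsub⟩ := hzd.mem_nhds_iff.mp
    (inter_mem (inter_mem hVx hN) (isOpen_compl_singleton.mem_nhds hyx.symm))
  exact ⟨V', hV', hxV', fun z hz => (hsub hz).1.1, fun z hz => (hsub hz).1.2,
    y, hyV, fun hy => (hsub hy).2 rfl⟩

/-- Every point of a clopen set has a strictly decreasing base of clopen neighbourhoods that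
starts with that set. -/
lemma exists_strictAnti_clopen_basis (hzd : IsTopologicalBasis {s : Set X | IsClopen s})
    {x : X} {U : Set X} (hU : IsClopen U) (hx : x ∈ U) :
    ∃ V : ℕ → Set X, V 0 = U ∧ (∀ n, IsClopen (V n)) ∧ (∀ n, x ∈ V n) ∧ Antitone V ∧
      (∀ n, (V n \ V (n + 1)).Nonempty) ∧ ∀ N ∈ 𝓝 x, ∃ n, V n ⊆ N := by
  obtain ⟨b, hb⟩ := (𝓝 x).exists_antitone_basis
  have hstep : ∀ (n : ℕ) (V : {V : Set X // IsClopen V ∧ x ∈ V}),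
      ∃ V' : {V : Set X // IsClopen V ∧ x ∈ V},
        V'.1 ⊆ V.1 ∧ V'.1 ⊆ b n ∧ (V.1 \ V'.1).Nonempty := by
    rintro n ⟨V, hV, hxV⟩
    obtain ⟨V', h1, h2, h3⟩ := exists_clopen_ssubset hzd hV hxV (hb.mem n)
    exact ⟨⟨V', h1, h2⟩, h3⟩
  choose next hnext using hstep
  let V : ℕ → {V : Set X // IsClopen V ∧ x ∈ V} := fun n => Nat.rec ⟨U, hU, hx⟩ next n
  have hV : ∀ n, V (n + 1) = next n (V n) := fun n => rfl
  refine ⟨fun n => (V n).1, rfl, fun n => (V n).2.1, fun n => (V n).2.2,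
    antitone_nat_of_succ_le fun n => ?_, fun n => ?_, fun N hN => ?_⟩
  · rw [hV]
    exact (hnext n (V n)).1
  · simp only [hV]
    exact (hnext n (V n)).2.2
  · obtain ⟨n, -, hn⟩ := hb.1.mem_iff.mp hN
    refine ⟨n + 1, ?_⟩
    simp only [hV]
    exact (hnext n (V n)).2.1.trans hn

/-- A punctured clopen set is partitioned into labelled clopen cells, each of them deciding `B`,
such that cells of every label accumulate at the puncture. -/
lemma exists_labelled_splitting (hzd : IsTopologicalBasis {s : Set X | IsClopen s})
    {W : Type*} [Finite W] {x : X} {U B : Set X} (hU : IsClopen U) (hx : x ∈ U)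
    (hB : IsClopen B) {L : Set W} (hL : L.Nonempty) :
    ∃ (A : X → Set X) (l : X → W),
      (∀ y ∈ U, y ≠ x → y ∈ A y ∧ IsClopen (A y) ∧ A y ⊆ U ∧ x ∉ A y ∧ (y ∈ B → A y ⊆ B) ∧
        l y ∈ L ∧ ∀ z ∈ A y, A z = A y ∧ l z = l y) ∧
      ∀ w ∈ L, ∀ N ∈ 𝓝 x, ∃ y ∈ U, y ≠ x ∧ A y ⊆ N ∧ l y = w := by
  classical
  obtain ⟨V, hV0, hVc, hxV, hanti, hne, hbasis⟩ := exists_strictAnti_clopen_basis hzd hU hx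
  have : Nonempty L := hL.to_subtype
  obtain ⟨e, he⟩ := exists_surjective_nat L
  have hex : ∀ y ∈ U, y ≠ x → ∃ n, y ∈ V n \ V (n + 1) := by
    intro y hy hyx
    obtain ⟨n, hn⟩ := hbasis _ (isOpen_compl_singleton.mem_nhds hyx.symm)
    have h : ∃ n, y ∉ V n := ⟨n, fun h => hn h rfl⟩
    have hpos : Nat.find h ≠ 0 := fun h0 => by
      have := Nat.find_spec h
      rw [h0, hV0] at this
      exact this hy
    obtain ⟨m, hm⟩ := Nat.exists_eq_succ_of_ne_zero hpos
    refine ⟨m, not_not.mp (Nat.find_min h (m := m) (by omega)), ?_⟩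
    have := Nat.find_spec h
    rwa [hm] at this
  have huniq : ∀ y m n, y ∈ V m \ V (m + 1) → y ∈ V n \ V (n + 1) → m = n := by
    intro y m n hm hn
    rcases lt_trichotomy m n with h | h | h
    · exact absurd (hanti (Nat.succ_le_of_lt h) hn.1) hm.2
    · exact h
    · exact absurd (hanti (Nat.succ_le_of_lt h) hm.1) hn.2
  choose! idx hidx using hex
  have hsubU : ∀ n, V n ⊆ U := fun n => hV0 ▸ hanti (Nat.zero_le n)
  have hshell : ∀ n z, z ∈ V n \ V (n + 1) → z ∈ U ∧ z ≠ x ∧ idx z = n := by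
    intro n z hz
    have hzx : z ≠ x := fun h => hz.2 (h ▸ hxV (n + 1))
    exact ⟨hsubU n hz.1, hzx, huniq z _ _ (hidx z (hsubU n hz.1) hzx) hz⟩
  refine ⟨fun y => (V (idx y) \ V (idx y + 1)) ∩ {z | z ∈ B ↔ y ∈ B},
    fun y => (e (Nat.unpair (idx y)).1 : W), ?_, ?_⟩
  · intro y hy hyx
    refine ⟨⟨hidx y hy hyx, Iff.rfl⟩, ?_, fun z hz => hsubU _ hz.1.1,
      fun h => h.1.2 (hxV _), fun hyB z hz => hz.2.mpr hyB, Subtype.coe_prop _, ?_⟩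
    · refine ((hVc _).diff (hVc _)).inter ?_
      by_cases hyB : y ∈ B
      · simpa [hyB] using hB
      · simp only [hyB, iff_false]
        exact hB.compl
    · rintro z ⟨hz, hzB⟩
      have h := (hshell _ z hz).2.2
      have hzB' : z ∈ B ↔ y ∈ B := hzB
      simp only [h, hzB', and_self]
  · intro w hw N hN
    obtain ⟨m, hm⟩ := hbasis N hN
    obtain ⟨k, hk⟩ := he ⟨w, hw⟩
    obtain ⟨y, hy⟩ := hne (Nat.pair k m)
    obtain ⟨hyU, hyx, hyi⟩ := hshell _ y hy
    refine ⟨y, hyU, hyx, ?_, ?_⟩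
    · rintro z ⟨hz, -⟩
      rw [hyi] at hz
      exact hm (hanti (Nat.right_le_pair k m) hz.1)
    · simp [hyi, hk]

lemma exists_surjective_isLocallyConstant [Nonempty X]
    (hzd : IsTopologicalBasis {s : Set X | IsClopen s})
    (W : Type*) [Finite W] [Nonempty W] :
    ∃ g : X → W, IsLocallyConstant g ∧ Function.Surjective g := by
  classical
  obtain ⟨x⟩ := ‹Nonempty X›
  obtain ⟨w₀⟩ := ‹Nonempty W›
  obtain ⟨A, l, hA, hl⟩ := exists_labelled_splitting hzd (isClopen_univ) (mem_univ x)
    isClopen_univ (L := (univ : Set W)) ⟨w₀, mem_univ w₀⟩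
  have hpt : ∀ w, ∃ y, y ≠ x ∧ l y = w := fun w => by
    obtain ⟨y, -, hy, -, hw⟩ := hl w (mem_univ w) univ univ_mem
    exact ⟨y, hy, hw⟩
  choose q hqx hql using hpt
  have hN : IsClopen (⋂ w, (A (q w))ᶜ) :=
    isClopen_iInter_of_finite fun w => (hA (q w) (mem_univ _) (hqx w)).2.1.compl
  have hxN : x ∈ ⋂ w, (A (q w))ᶜ :=
    mem_iInter.mpr fun w => (hA (q w) (mem_univ _) (hqx w)).2.2.2.1
  refine ⟨fun y => if y ∈ ⋂ w, (A (q w))ᶜ then w₀ else l y,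
    (IsLocallyConstant.iff_exists_open _).mpr fun y => ?_, fun w => ⟨q w, ?_⟩⟩
  · by_cases hy : y ∈ ⋂ w, (A (q w))ᶜ
    · exact ⟨_, hN.isOpen, hy, fun z hz => by rw [if_pos hz, if_pos hy]⟩
    · have hyx : y ≠ x := fun h => hy (h ▸ hxN)
      obtain ⟨h1, h2, -, -, -, -, h3⟩ := hA y (mem_univ y) hyx
      refine ⟨A y ∩ (⋂ w, (A (q w))ᶜ)ᶜ, h2.isOpen.inter hN.compl.isOpen, ⟨h1, hy⟩, ?_⟩
      intro z hz
      rw [if_neg hz.2, if_neg hy]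
      exact (h3 z hz.1).2
  · have : q w ∉ ⋂ w, (A (q w))ᶜ := fun h =>
      mem_iInter.mp h w (hA (q w) (mem_univ _) (hqx w)).1
    exact (if_neg this).trans (hql w)

end Splitting

/-- A sequence of successively finer partitions of `X` into cells labelled by `W`. The cell
`cell n y` is the part containing `y` at level `n`. Each cell has a base point, which is split off
as a singleton at the next level, while all other points pass to open cells labelled by
`R`-successors. -/
structure LabelledRefinement (X : Type*) [TopologicalSpace X] {W : Type*} (R : W → W → Prop) where
  cell : ℕ → X → Set X
  label : ℕ → X → W
  base : Set X → X
  mem_cell : ∀ n y, y ∈ cell n y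
  cell_eq : ∀ n y, ∀ z ∈ cell n y, cell n z = cell n y
  label_eq : ∀ n y, ∀ z ∈ cell n y, label n z = label n y
  base_mem : ∀ n y, base (cell n y) ∈ cell n y
  cell_succ_of_base : ∀ n y, y = base (cell n y) → cell (n + 1) y = {y}
  label_succ_of_base : ∀ n y, y = base (cell n y) → label (n + 1) y = label n y
  isOpen_cell : ∀ n y, y ≠ base (cell n y) → IsOpen (cell n y)
  isOpen_cell_succ : ∀ n y, y ≠ base (cell n y) → IsOpen (cell (n + 1) y)
  cell_succ_subset : ∀ n y, y ≠ base (cell n y) → cell (n + 1) y ⊆ cell n y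
  base_notMem_cell_succ : ∀ n y, y ≠ base (cell n y) → base (cell n y) ∉ cell (n + 1) y
  rel_label_succ : ∀ n y, y ≠ base (cell n y) → R (label n y) (label (n + 1) y)
  exists_cell_subset : ∀ y, (∀ n, y ≠ base (cell n y)) → ∀ N ∈ 𝓝 y, ∃ n, cell n y ⊆ N
  exists_label_succ_eq : ∀ n y w, IsOpen (cell n y) → R (label n y) w →
    ∀ N ∈ 𝓝 (base (cell n y)),
      ∃ z ∈ cell n y, z ≠ base (cell n y) ∧ cell (n + 1) z ⊆ N ∧ label (n + 1) z = w
  isOpen_cell_zero : ∀ y, IsOpen (cell 0 y)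
  cell_zero : ∀ y, cell 0 y = label 0 ⁻¹' {label 0 y}
  label_zero_surjective : Function.Surjective (label 0)

section Existence

variable {X : Type*} [MetricSpace X] [Nonempty X] [SeparableSpace X]

lemma exists_seq_clopen_basis (hzd : IsTopologicalBasis {s : Set X | IsClopen s}) :
    ∃ B : ℕ → Set X, (∀ n, IsClopen (B n)) ∧ ∀ x, ∀ N ∈ 𝓝 x, ∃ n, x ∈ B n ∧ B n ⊆ N := by
  have : SecondCountableTopology X := UniformSpace.secondCountable_of_separable X
  obtain ⟨b, hbs, hbc, hb⟩ := hzd.exists_countable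
  have hbne : b.Nonempty := by
    obtain ⟨x⟩ := ‹Nonempty X›
    obtain ⟨s, hs, -⟩ := hb.mem_nhds_iff.mp (univ_mem (f := 𝓝 x))
    exact ⟨s, hs⟩
  obtain ⟨B, rfl⟩ := hbc.exists_eq_range hbne
  refine ⟨B, fun n => hbs (mem_range_self n), fun x N hN => ?_⟩
  obtain ⟨_, ⟨n, rfl⟩, hx, hsub⟩ := hb.mem_nhds_iff.mp hN
  exact ⟨n, hx, hsub⟩

theorem nonempty_labelledRefinement [PerfectSpace X]
    (hzd : IsTopologicalBasis {s : Set X | IsClopen s})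
    {W : Type*} [Finite W] [Nonempty W] (R : W → W → Prop) (hserial : ∀ w, ∃ v, R w v) :
    Nonempty (LabelledRefinement X R) := by
  classical
  obtain ⟨B, hBc, hB⟩ := exists_seq_clopen_basis hzd
  obtain ⟨g, hg, hgs⟩ := exists_surjective_isLocallyConstant hzd W
  have hp : ∀ C : Set X, ∃ x, C.Nonempty → x ∈ C := fun C => by
    by_cases h : C.Nonempty
    · exact ⟨h.some, fun _ => h.some_mem⟩
    · exact ⟨Classical.arbitrary X, fun h' => absurd h' h⟩
  choose p hp using hp
  have hsplit : ∀ (n : ℕ) (C : Set X) (w : W), ∃ (A : X → Set X) (l : X → W),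
      IsClopen C → C.Nonempty →
      (∀ y ∈ C, y ≠ p C → y ∈ A y ∧ IsClopen (A y) ∧ A y ⊆ C ∧ p C ∉ A y ∧
        (y ∈ B n → A y ⊆ B n) ∧ l y ∈ {v | R w v} ∧ ∀ z ∈ A y, A z = A y ∧ l z = l y) ∧
      ∀ v ∈ {v | R w v}, ∀ N ∈ 𝓝 (p C), ∃ y ∈ C, y ≠ p C ∧ A y ⊆ N ∧ l y = v := by
    intro n C w
    by_cases h : IsClopen C ∧ C.Nonempty
    · obtain ⟨A, l, h'⟩ := exists_labelled_splitting hzd h.1 (hp C h.2) (hBc n)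
        (L := {v | R w v}) (hserial w)
      exact ⟨A, l, fun _ _ => h'⟩
    · exact ⟨fun _ => ∅, fun _ => w, fun h1 h2 => absurd ⟨h1, h2⟩ h⟩
  choose A l hA hl using hsplit
  let S : ℕ → X → Set X × W := fun n => Nat.rec (fun y => (g ⁻¹' {g y}, g y))
    (fun n S y => if y = p (S y).1 then ({y}, (S y).2) else
      (A n (S y).1 (S y).2 y, l n (S y).1 (S y).2 y)) n
  have hS0 : ∀ y, S 0 y = (g ⁻¹' {g y}, g y) := fun y => rfl
  have hSpos : ∀ n y, y = p (S n y).1 → S (n + 1) y = ({y}, (S n y).2) :=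
    fun n y h => if_pos h
  have hSneg : ∀ n y, y ≠ p (S n y).1 → S (n + 1) y =
      (A n (S n y).1 (S n y).2 y, l n (S n y).1 (S n y).2 y) := fun n y h => if_neg h
  have hpsing : ∀ y : X, p {y} = y := fun y => hp {y} (singleton_nonempty y)
  have hinv : ∀ n y, y ∈ (S n y).1 ∧ ((S n y).1 = {y} ∨ IsClopen (S n y).1) ∧
      ∀ z ∈ (S n y).1, S n z = S n y := by
    intro n
    induction n with
    | zero =>
      intro y
      refine ⟨rfl, Or.inr (hg.isClopen_fiber (g y)), fun z hz => ?_⟩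
      have hz : g z = g y := hz
      rw [hS0, hS0, hz]
    | succ n ih =>
      intro y
      obtain ⟨h1, h2, h3⟩ := ih y
      by_cases hy : y = p (S n y).1
      · rw [hSpos n y hy]
        refine ⟨rfl, Or.inl rfl, fun z hz => ?_⟩
        have hz : z = y := hz
        rw [hz, hSpos n y hy]
      · have hc : IsClopen (S n y).1 := h2.resolve_left fun h => hy (by rw [h, hpsing])
        obtain ⟨k1, k2, k3, k4, -, -, k5⟩ := hA n _ (S n y).2 hc ⟨y, h1⟩ y h1 hy
        rw [hSneg n y hy]
        refine ⟨k1, Or.inr k2, fun z hz => ?_⟩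
        have hzS : S n z = S n y := h3 z (k3 hz)
        have hzp : z ≠ p (S n z).1 := by
          rw [hzS]
          rintro h
          exact k4 (h ▸ hz)
        rw [hSneg n z hzp, hzS, (k5 z hz).1, (k5 z hz).2]
  have hclopen : ∀ n y, y ≠ p (S n y).1 → IsClopen (S n y).1 := fun n y hy =>
    (hinv n y).2.1.resolve_left fun h => hy (by rw [h, hpsing])
  have hmove := fun n y (hy : y ≠ p (S n y).1) =>
    hA n _ (S n y).2 (hclopen n y hy) ⟨y, (hinv n y).1⟩ y (hinv n y).1 hy
  refine ⟨{
    cell := fun n y => (S n y).1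
    label := fun n y => (S n y).2
    base := p
    mem_cell := fun n y => (hinv n y).1
    cell_eq := fun n y z hz => by rw [(hinv n y).2.2 z hz]
    label_eq := fun n y z hz => by rw [(hinv n y).2.2 z hz]
    base_mem := fun n y => hp _ ⟨y, (hinv n y).1⟩
    cell_succ_of_base := fun n y hy => by rw [hSpos n y hy]
    label_succ_of_base := fun n y hy => by rw [hSpos n y hy]
    isOpen_cell := fun n y hy => (hclopen n y hy).isOpen
    isOpen_cell_succ := fun n y hy => by
      rw [hSneg n y hy]
      exact (hmove n y hy).2.1.isOpen
    cell_succ_subset := fun n y hy => by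
      rw [hSneg n y hy]
      exact (hmove n y hy).2.2.1
    base_notMem_cell_succ := fun n y hy => by
      rw [hSneg n y hy]
      exact (hmove n y hy).2.2.2.1
    rel_label_succ := fun n y hy => by
      rw [hSneg n y hy]
      exact (hmove n y hy).2.2.2.2.2.1
    exists_cell_subset := fun y hy N hN => by
      obtain ⟨n, hyn, hn⟩ := hB y N hN
      refine ⟨n + 1, ?_⟩
      rw [hSneg n y (hy n)]
      exact ((hmove n y (hy n)).2.2.2.2.1 hyn).trans hn
    exists_label_succ_eq := fun n y w ho hw N hN => by
      have hc : IsClopen (S n y).1 := (hinv n y).2.1.elim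
        (fun h => h ▸ ⟨isClosed_singleton, h ▸ ho⟩) id
      obtain ⟨z, hz, hzp, hzN, hzw⟩ := hl n _ (S n y).2 hc ⟨y, (hinv n y).1⟩ w hw N hN
      have hzS := (hinv n y).2.2 z hz
      refine ⟨z, hz, hzp, ?_⟩
      rw [hSneg n z (by rwa [hzS]), hzS]
      exact ⟨hzN, hzw⟩
    isOpen_cell_zero := fun y => (hg.isClopen_fiber (g y)).isOpen
    cell_zero := fun y => rfl
    label_zero_surjective := hgs }⟩

end Existence

namespace LabelledRefinement

variable {X W : Type*} [TopologicalSpace X] {R : W → W → Prop} (P : LabelledRefinement X R)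

/-- The point `y` is the base point of its cell at level `n`. -/
def IsBase (n : ℕ) (y : X) : Prop := y = P.base (P.cell n y)

lemma isBase_base (n : ℕ) (y : X) : P.IsBase n (P.base (P.cell n y)) := by
  rw [IsBase, P.cell_eq n y _ (P.base_mem n y)]

lemma IsBase.succ {n : ℕ} {y : X} (h : P.IsBase n y) : P.IsBase (n + 1) y := by
  have hm := P.base_mem (n + 1) y
  rw [P.cell_succ_of_base n y h] at hm
  rw [IsBase, P.cell_succ_of_base n y h]
  exact hm.symm

lemma IsBase.label_eq {n m : ℕ} {y : X} (h : P.IsBase n y) (hnm : n ≤ m) :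
    P.label m y = P.label n y := by
  have key : P.IsBase m y ∧ P.label m y = P.label n y := by
    induction m, hnm using Nat.le_induction with
    | base => exact ⟨h, rfl⟩
    | succ m _ ih => exact ⟨ih.1.succ, (P.label_succ_of_base m y ih.1).trans ih.2⟩
  exact key.2

lemma rel_label (htrans : Transitive R) {n m : ℕ} {y : X} (h : ¬ P.IsBase n y) (hnm : n < m) :
    R (P.label n y) (P.label m y) := by
  induction m, Nat.succ_le_of_lt hnm using Nat.le_induction with
  | base => exact P.rel_label_succ n y h
  | succ m hm ih =>
    by_cases hb : P.IsBase m y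
    · rw [P.label_succ_of_base m y hb]
      exact ih hm
    · exact htrans (ih hm) (P.rel_label_succ m y hb)

lemma cell_anti {y : X} (hy : ∀ n, ¬ P.IsBase n y) : Antitone fun n => P.cell n y :=
  antitone_nat_of_succ_le fun n => P.cell_succ_subset n y (hy n)

lemma IsBase.exists_isOpen {n : ℕ} {y : X} (h : P.IsBase n y) :
    ∃ m, P.IsBase m y ∧ IsOpen (P.cell m y) := by
  induction n with
  | zero => exact ⟨0, h, P.isOpen_cell_zero y⟩
  | succ n ih =>
    by_cases hb : P.IsBase n y
    · exact ih hb
    · exact ⟨n + 1, h, P.isOpen_cell_succ n y hb⟩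

lemma exists_frequently_label_eq [Finite W] (y : X) : ∃ w, ∀ n, ∃ m > n, P.label m y = w := by
  obtain ⟨w, hw⟩ := Finite.exists_infinite_fiber fun n => P.label n y
  refine ⟨w, fun n => ?_⟩
  obtain ⟨m, hm, hnm⟩ := (infinite_coe_iff.mp hw).exists_gt n
  exact ⟨m, hnm, hm⟩

variable [Finite W]

/-- A label that the cells around `y` carry at infinitely many levels. -/
noncomputable def limitLabel (y : X) : W := (P.exists_frequently_label_eq y).choose

lemma exists_label_eq_limitLabel (y : X) (n : ℕ) : ∃ m > n, P.label m y = P.limitLabel y :=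
  (P.exists_frequently_label_eq y).choose_spec n

lemma IsBase.limitLabel_eq {n : ℕ} {y : X} (h : P.IsBase n y) :
    P.limitLabel y = P.label n y := by
  obtain ⟨m, hm, heq⟩ := P.exists_label_eq_limitLabel y n
  rw [← heq, h.label_eq P hm.le]

lemma rel_limitLabel (htrans : Transitive R) {n : ℕ} {y : X} (h : ¬ P.IsBase n y) :
    R (P.label n y) (P.limitLabel y) := by
  obtain ⟨m, hm, heq⟩ := P.exists_label_eq_limitLabel y n
  exact heq ▸ P.rel_label htrans h hm

/-- Near the base point of an open cell, all successors of the label of the cell are limit labels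
of base points. -/
lemma exists_isBase_limitLabel_eq {n : ℕ} {y : X} {w : W} (ho : IsOpen (P.cell n y))
    (hw : R (P.label n y) w) {N : Set X} (hN : N ∈ 𝓝 (P.base (P.cell n y))) :
    ∃ q ∈ N, q ≠ P.base (P.cell n y) ∧ P.IsBase (n + 1) q ∧ P.limitLabel q = w := by
  obtain ⟨z, hz, hzb, hzN, hzw⟩ := P.exists_label_succ_eq n y w ho hw N hN
  have hq := P.base_mem (n + 1) z
  have hb := P.isBase_base (n + 1) z
  refine ⟨P.base (P.cell (n + 1) z), hzN hq, fun h => ?_, hb, ?_⟩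
  · rw [← P.cell_eq n y z hz] at hzb h
    exact P.base_notMem_cell_succ n z hzb (h ▸ hq)
  · rw [hb.limitLabel_eq, P.label_eq _ _ _ hq, hzw]

lemma mem_derivedSet_iff_of_isBase (htrans : Transitive R) {n : ℕ} {x : X}
    (h : P.IsBase n x) (w : W) :
    x ∈ derivedSet (P.limitLabel ⁻¹' {w}) ↔ R (P.limitLabel x) w := by
  obtain ⟨m, hm, ho⟩ := h.exists_isOpen P
  rw [mem_derivedSet, accPt_iff_nhds, hm.limitLabel_eq]
  constructor
  · intro hacc
    obtain ⟨z, ⟨hzC, rfl⟩, hzx⟩ := hacc _ (ho.mem_nhds (P.mem_cell m x))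
    rw [← P.label_eq m x z hzC]
    refine P.rel_limitLabel htrans fun hz => hzx ?_
    rw [hz, P.cell_eq m x z hzC]
    exact hm.symm
  · intro hw N hN
    have hb : P.base (P.cell m x) = x := hm.symm
    obtain ⟨q, hqN, hqx, -, hqw⟩ := P.exists_isBase_limitLabel_eq ho hw (N := N) (by rwa [hb])
    exact ⟨q, ⟨hqN, hqw⟩, fun h => hqx (h.trans hb.symm)⟩

lemma mem_derivedSet_iff_of_forall_not_isBase (htrans : Transitive R) {x : X}
    (h : ∀ n, ¬ P.IsBase n x) (w : W) :
    x ∈ derivedSet (P.limitLabel ⁻¹' {w}) ↔ R (P.limitLabel x) w := by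
  rw [mem_derivedSet, accPt_iff_nhds]
  constructor
  · intro hacc
    obtain ⟨k, -, hk⟩ := P.exists_label_eq_limitLabel x 0
    have hR : R (P.limitLabel x) (P.label (k + 1) x) := hk ▸ P.rel_label_succ k x (h k)
    obtain ⟨z, ⟨hzC, rfl⟩, -⟩ :=
      hacc _ ((P.isOpen_cell (k + 1) x (h _)).mem_nhds (P.mem_cell (k + 1) x))
    rw [← P.label_eq (k + 1) x z hzC] at hR
    by_cases hz : P.IsBase (k + 1) z
    · rwa [hz.limitLabel_eq]
    · exact htrans hR (P.rel_limitLabel htrans hz)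
  · intro hw N hN
    obtain ⟨n, hn⟩ := P.exists_cell_subset x h N hN
    obtain ⟨m, hm, hlab⟩ := P.exists_label_eq_limitLabel x n
    have ho := P.isOpen_cell m x (h m)
    obtain ⟨q, hqC, -, hqb, hqw⟩ := P.exists_isBase_limitLabel_eq ho (hlab ▸ hw)
      (ho.mem_nhds (P.base_mem m x))
    exact ⟨q, ⟨hn (P.cell_anti h hm.le hqC), hqw⟩, fun hqx => h _ (hqx ▸ hqb)⟩

theorem derivedSet_limitLabel_preimage (htrans : Transitive R) (w : W) :
    derivedSet (P.limitLabel ⁻¹' {w}) = P.limitLabel ⁻¹' {v | R v w} := by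
  ext x
  by_cases h : ∃ n, P.IsBase n x
  · obtain ⟨n, hn⟩ := h
    exact P.mem_derivedSet_iff_of_isBase htrans hn w
  · exact P.mem_derivedSet_iff_of_forall_not_isBase htrans (not_exists.mp h) w

theorem limitLabel_surjective : Function.Surjective P.limitLabel := by
  intro w
  obtain ⟨y, rfl⟩ := P.label_zero_surjective w
  exact ⟨_, ((P.isBase_base 0 y).limitLabel_eq P).trans (P.label_eq 0 y _ (P.base_mem 0 y))⟩

theorem limitLabel_preimage_eq_singleton (htrans : Transitive R) {w : W}
    (hw : {v | R v w} = ∅) : ∃ x, P.limitLabel ⁻¹' {w} = {x} := by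
  have hbase : ∀ z, P.limitLabel z = w → P.IsBase 0 z := fun z hz => by
    by_contra hb
    exact eq_empty_iff_forall_notMem.mp hw _ (hz ▸ P.rel_limitLabel htrans hb)
  obtain ⟨x, hx⟩ := P.limitLabel_surjective w
  refine ⟨x, eq_singleton_iff_unique_mem.mpr ⟨hx, fun z hz => ?_⟩⟩
  have hbx := hbase x hx
  have hbz := hbase z hz
  have hlab : P.label 0 z = P.label 0 x := by
    rw [← hbx.limitLabel_eq, ← hbz.limitLabel_eq, hx]
    exact hz
  rw [hbx, hbz, P.cell_zero z, P.cell_zero x, hlab]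

end LabelledRefinement

end DMorphism

/-- every zero-dimensional dense-in-itself separable metric space
admits a d-morphism onto any finite D4-frame which is 1-fold at all strictly
minimal points. -/
theorem dMorphism_onto_finite_D4_frame_onefold_at_minimal
    {X : Type*} [MetricSpace X] [Nonempty X] [SeparableSpace X] [PerfectSpace X]
    (hzd : IsTopologicalBasis {s : Set X | IsClopen s})
    {W : Type*} [Finite W] [Nonempty W] (R : W → W → Prop)
    (htrans : Transitive R) (hserial : ∀ w, ∃ v, R w v) :
    ∃ f : X → W, Function.Surjective f ∧
      (∀ w, derivedSet (f ⁻¹' {w}) = f ⁻¹' {v | R v w}) ∧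
      (∀ w : W, {v | R v w} = ∅ → ∃ x : X, f ⁻¹' {w} = {x}) := by
  obtain ⟨P⟩ := DMorphism.nonempty_labelledRefinement hzd R hserial
  exact ⟨P.limitLabel, P.limitLabel_surjective, P.derivedSet_limitLabel_preimage htrans,
    fun _ hw => P.limitLabel_preimage_eq_singleton htrans hw⟩
end

section
/- Let X be a zero-dimensional dense-in-itself separable metric space and F = (W,R,R_D) a finite DT1-frame. Then there exists a dd-morphism from X onto F: a surjective f : X → W such that (i) d(f⁻¹(w)) = f⁻¹(R⁻¹(w)) for every w ∈ W; (ii) f(x) R_D f(y) whenever x ≠ y in X; and (iii) whenever f(x) R_D w there exists y ∈ X with y ≠ x and f(y) = w. -/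
open TopologicalSpace

namespace DDMorphism

open Topology

/-- A partition of `X` into clopen pieces; each piece contains a base point and carries a label. -/
structure Labelling (X W : Type*) [TopologicalSpace X] where
  /-- The base point of the piece containing a given point. -/
  base : X → X
  /-- The label of the piece containing a given point. -/
  label : X → W
  locConst : IsLocallyConstant base
  base_base : ∀ x, base (base x) = base x
  label_base : ∀ x, label (base x) = label x

theorem Labelling.label_congr {X W : Type*} [TopologicalSpace X] (S : Labelling X W) {x y : X}
    (h : S.base x = S.base y) : S.label x = S.label y := by
  rw [← S.label_base x, h, S.label_base]

/-- `S'` refines `S` and decides membership in `B`: the base points of `S` and their labels are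
kept, and the new pieces inside a piece labelled `w` carry exactly the labels in `R w`. -/
structure Refines {X W : Type*} [TopologicalSpace X] (R : W → W → Prop) (B : Set X)
    (S S' : Labelling X W) : Prop where
  base_old : ∀ x, S'.base (S.base x) = S.base x
  label_old : ∀ x, S'.label (S.base x) = S.label x
  finer : ∀ x y, S'.base x = S'.base y → S.base x = S.base y
  decides : ∀ x y, S'.base x = S'.base y → (x ∈ B ↔ y ∈ B)
  step : ∀ x, S'.base x = S.base x ∨ R (S.label x) (S'.label x)
  split : ∀ x v, R (S.label x) v →
    ∃ y, S.base y = S.base x ∧ S'.base y = y ∧ y ≠ S.base x ∧ S'.label y = v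

theorem exists_injective_mem {X I : Type*} [Finite I] {S : Set X} (hS : S.Infinite) :
    ∃ z : I → X, Function.Injective z ∧ ∀ i, z i ∈ S := by
  obtain ⟨n, ⟨e⟩⟩ := Finite.exists_equiv_fin I
  refine ⟨fun i => hS.natEmbedding S (e i), ?_, fun i => (hS.natEmbedding S (e i)).2⟩
  intro i j hij
  exact e.injective (Fin.val_injective ((hS.natEmbedding S).injective (Subtype.ext hij)))

theorem infinite_of_isOpen {X : Type*} [TopologicalSpace X] [T1Space X] [PerfectSpace X]
    {A : Set X} (hA : IsOpen A) {a : X} (ha : a ∈ A) : A.Infinite :=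
  infinite_of_mem_nhds a (hA.mem_nhds ha)

theorem exists_clopen_seq {X : Type*} [TopologicalSpace X] [SecondCountableTopology X] [Nonempty X]
    (hzd : IsTopologicalBasis {s : Set X | IsClopen s}) :
    ∃ B : ℕ → Set X, (∀ n, IsClopen (B n)) ∧
      ∀ (x : X) (U : Set X), IsOpen U → x ∈ U → ∃ n, x ∈ B n ∧ B n ⊆ U := by
  obtain ⟨b, hb, hbc, hbb⟩ := hzd.exists_countable
  have hne : b.Nonempty := by
    obtain ⟨x⟩ := ‹Nonempty X›
    obtain ⟨s, hs, -⟩ := hbb.exists_subset_of_mem_open (Set.mem_univ x) isOpen_univ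
    exact ⟨s, hs⟩
  obtain ⟨B, rfl⟩ := hbc.exists_eq_range hne
  refine ⟨B, fun n => hb ⟨n, rfl⟩, fun x U hU hx => ?_⟩
  obtain ⟨_, ⟨n, rfl⟩, h⟩ := hbb.exists_subset_of_mem_open hx hU
  exact ⟨n, h⟩

theorem isLocallyConstant_trace {X : Type*} [TopologicalSpace X] {B : ℕ → Set X}
    (hB : ∀ n, IsClopen (B n)) (N : ℕ) :
    IsLocallyConstant (fun x => {i | i < N ∧ x ∈ B i}) := by
  rw [IsLocallyConstant.iff_eventually_eq]
  intro x
  have h : ∀ i ∈ Finset.range N, ∀ᶠ y in 𝓝 x, (y ∈ B i ↔ x ∈ B i) := by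
    intro i _
    by_cases hx : x ∈ B i
    · filter_upwards [(hB i).isOpen.mem_nhds hx] with y hy using by simp [hx, hy]
    · filter_upwards [(hB i).compl.isOpen.mem_nhds hx] with y hy using by
        simpa [hx] using hy
  filter_upwards [(Filter.eventually_all_finset _).2 h] with y hy
  ext i
  simp only [Set.mem_ofPred_eq]
  exact and_congr_right fun hi => hy i (Finset.mem_range.2 hi)

theorem exists_trace_injective {X I : Type*} [TopologicalSpace X] [T1Space X] [Finite I]
    {B : ℕ → Set X}
    (hB : ∀ (x : X) (U : Set X), IsOpen U → x ∈ U → ∃ n, x ∈ B n ∧ B n ⊆ U)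
    {z : I → X} (hz : Function.Injective z) (n : ℕ) :
    ∃ N, n < N ∧ Function.Injective fun i => {k | k < N ∧ z i ∈ B k} := by
  have h : ∀ ij : I × I, ∃ k, ij.1 ≠ ij.2 → z ij.1 ∈ B k ∧ z ij.2 ∉ B k := by
    rintro ⟨i, j⟩
    by_cases hij : i = j
    · exact ⟨0, fun h => absurd hij h⟩
    · obtain ⟨k, hk, hk'⟩ := hB (z i) {z j}ᶜ isOpen_compl_singleton (fun h => hij (hz h))
      exact ⟨k, fun _ => ⟨hk, fun h => hk' h rfl⟩⟩
  choose k hk using h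
  obtain ⟨M, hM⟩ := (Set.finite_range k).bddAbove
  refine ⟨max M n + 1, by omega, fun i j hij => ?_⟩
  by_contra hne
  obtain ⟨h1, h2⟩ := hk (i, j) hne
  have hle : k (i, j) ≤ M := hM ⟨_, rfl⟩
  have h3 : k (i, j) ∈ {k | k < max M n + 1 ∧ z i ∈ B k} := ⟨by omega, h1⟩
  have hij' : {k | k < max M n + 1 ∧ z i ∈ B k} = {k | k < max M n + 1 ∧ z j ∈ B k} := hij
  rw [hij'] at h3
  exact h2 h3.2

/-- Partition a set `A` into relatively clopen pieces, with prescribed base points `z i`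
labelled `e i`, all other pieces being labelled `d`. -/
theorem exists_partition {X W I : Type*} [TopologicalSpace X] [T1Space X] [Nonempty X] [Finite I]
    {B : ℕ → Set X} (hBc : ∀ n, IsClopen (B n))
    (hB : ∀ (x : X) (U : Set X), IsOpen U → x ∈ U → ∃ n, x ∈ B n ∧ B n ⊆ U)
    {A : Set X} {z : I → X} (hz : Function.Injective z) (hzA : ∀ i, z i ∈ A)
    (e : I → W) (d : W) (n : ℕ) :
    ∃ (q : X → X) (m : X → W), IsLocallyConstant q ∧ (∀ x ∈ A, q x ∈ A) ∧
      (∀ x ∈ A, q (q x) = q x) ∧ (∀ x ∈ A, m (q x) = m x) ∧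
      (∀ i, q (z i) = z i) ∧ (∀ i, m (z i) = e i) ∧
      (∀ x ∈ A, ∀ y ∈ A, q x = q y → (x ∈ B n ↔ y ∈ B n)) ∧
      (∀ x ∈ A, (∃ i, q x = z i) ∨ m x = d) := by
  classical
  obtain ⟨N, hnN, hinj⟩ := exists_trace_injective hB hz n
  have hloc := isLocallyConstant_trace hBc N
  set h : X → Set ℕ := fun x => {i | i < N ∧ x ∈ B i} with hh
  have hinj' : Function.Injective (h ∘ z) := hinj
  have hr : ∀ k, ∃ y, (∃ x ∈ A, h x = k) → y ∈ A ∧ h y = k := fun k => by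
    by_cases hk : ∃ x ∈ A, h x = k
    · obtain ⟨x, hx⟩ := hk
      exact ⟨x, fun _ => hx⟩
    · exact ⟨Classical.arbitrary X, fun h => absurd h hk⟩
  choose r hr using hr
  let s : Set ℕ → X := Function.extend (h ∘ z) z r
  let t : Set ℕ → W := Function.extend (h ∘ z) e fun _ => d
  have hsz : ∀ i, s (h (z i)) = z i := fun i => hinj'.extend_apply z r i
  have htz : ∀ i, t (h (z i)) = e i := fun i => hinj'.extend_apply e _ i
  have hs : ∀ x ∈ A, s (h x) ∈ A ∧ h (s (h x)) = h x := by
    intro x hx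
    by_cases hk : ∃ i, (h ∘ z) i = h x
    · obtain ⟨i, hi⟩ := hk
      rw [← hi, Function.comp_apply, hsz]
      exact ⟨hzA i, rfl⟩
    · have : s (h x) = r (h x) := Function.extend_apply' _ _ _ hk
      rw [this]
      exact hr (h x) ⟨x, hx, rfl⟩
  refine ⟨s ∘ h, t ∘ h, hloc.comp s, fun x hx => (hs x hx).1, fun x hx => ?_, fun x hx => ?_,
    hsz, htz, fun x hx y hy hxy => ?_, fun x _ => ?_⟩
  · simp only [Function.comp_apply, (hs x hx).2]
  · simp only [Function.comp_apply, (hs x hx).2]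
  · have hxy' : h x = h y := by
      rw [← (hs x hx).2, ← (hs y hy).2]
      exact congrArg h hxy
    have := Set.ext_iff.1 hxy' n
    simpa [hh, hnN] using this
  · by_cases hk : ∃ i, (h ∘ z) i = h x
    · obtain ⟨i, hi⟩ := hk
      left
      refine ⟨i, ?_⟩
      rw [Function.comp_apply, ← hi, Function.comp_apply, hsz]
    · right
      exact Function.extend_apply' e (fun _ => d) (h x) hk

theorem exists_refines {X W : Type*} [TopologicalSpace X] [T1Space X] [PerfectSpace X] [Nonempty X]
    [Finite W] {B : ℕ → Set X} (hBc : ∀ n, IsClopen (B n))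
    (hB : ∀ (x : X) (U : Set X), IsOpen U → x ∈ U → ∃ n, x ∈ B n ∧ B n ⊆ U)
    {R : W → W → Prop} (hserial : ∀ w, ∃ v, R w v) (n : ℕ) (S : Labelling X W) :
    ∃ S', Refines R (B n) S S' := by
  classical
  have : Nonempty W := ⟨S.label (Classical.arbitrary X)⟩
  have key : ∀ a, S.base a = a → ∃ (q : X → X) (m : X → W), IsLocallyConstant q ∧
      (∀ x, S.base x = a → S.base (q x) = a) ∧
      (∀ x, S.base x = a → q (q x) = q x) ∧ (∀ x, S.base x = a → m (q x) = m x) ∧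
      q a = a ∧ m a = S.label a ∧
      (∀ x, S.base x = a → ∀ y, S.base y = a → q x = q y → (x ∈ B n ↔ y ∈ B n)) ∧
      (∀ x, S.base x = a → q x = a ∨ R (S.label a) (m x)) ∧
      (∀ v, R (S.label a) v → ∃ y, S.base y = a ∧ q y = y ∧ y ≠ a ∧ m y = v) := by
    intro a ha
    obtain ⟨d, hd⟩ := hserial (S.label a)
    have hAopen : IsOpen {x | S.base x = a} := S.locConst.isOpen_fiber a
    have hinf : ({x | S.base x = a} \ {a}).Infinite :=
      (infinite_of_isOpen hAopen (a := a) ha).sdiff (Set.finite_singleton a)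
    obtain ⟨z₀, hz₀, hz₀A⟩ := exists_injective_mem (I := W) hinf
    let z : Option W → X := fun o => o.elim a z₀
    have hz : Function.Injective z := by
      rintro (_ | i) (_ | j) hij
      · rfl
      · exact absurd hij.symm (hz₀A j).2
      · exact absurd hij (hz₀A i).2
      · exact congrArg some (hz₀ hij)
    have hzA : ∀ i, z i ∈ {x | S.base x = a} := by
      rintro (_ | i)
      · exact ha
      · exact (hz₀A i).1
    let e : Option W → W := fun o =>
      o.elim (S.label a) fun v => if R (S.label a) v then v else d
    have he : ∀ v, R (S.label a) (e (some v)) := by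
      intro v
      change R (S.label a) (if R (S.label a) v then v else d)
      split_ifs with h
      exacts [h, hd]
    obtain ⟨q, m, hq, hqA, hqq, hmq, hqz, hmz, hqB, hcov⟩ :=
      exists_partition hBc hB hz hzA e d n
    refine ⟨q, m, hq, hqA, hqq, hmq, hqz none, hmz none, hqB, fun x hx => ?_, fun v hv => ?_⟩
    · rcases hcov x hx with ⟨_ | v, hi⟩ | h
      · exact Or.inl hi
      · right
        rw [← hmq x hx, hi, hmz]
        exact he v
      · exact Or.inr (h ▸ hd)
    · refine ⟨z₀ v, (hz₀A v).1, hqz (some v), (hz₀A v).2, ?_⟩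
      exact (hmz (some v)).trans (if_pos hv)
  choose! q m hq hqA hqq hmq hqa hma hqB hcov hsplit using key
  have hbb := S.base_base
  have hAx : ∀ x, S.base (q (S.base x) x) = S.base x := fun x => hqA _ (hbb x) x rfl
  refine ⟨⟨fun x => q (S.base x) x, fun x => m (S.base x) x, ?_, fun x => ?_, fun x => ?_⟩,
    ⟨fun x => ?_, fun x => ?_, fun x y hxy => ?_, fun x y hxy => ?_, fun x => ?_,
      fun x v hv => ?_⟩⟩
  · rw [IsLocallyConstant.iff_eventually_eq]
    intro x
    filter_upwards [S.locConst.eventually_eq x, (hq _ (hbb x)).eventually_eq x] with y h1 h2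
    rw [h1, h2]
  · simp only [hAx]
    exact hqq _ (hbb x) x rfl
  · simp only [hAx]
    exact hmq _ (hbb x) x rfl
  · simp only [hbb]
    exact hqa _ (hbb x)
  · simp only [hbb]
    rw [hma _ (hbb x), S.label_base]
  · rw [← hAx x, ← hAx y]
    exact congrArg S.base hxy
  · have h : S.base x = S.base y := by
      rw [← hAx x, ← hAx y]
      exact congrArg S.base hxy
    refine hqB _ (hbb x) x rfl y h.symm ?_
    simpa only [← h] using hxy
  · simpa only [S.label_base] using hcov _ (hbb x) x rfl
  · rw [← S.label_base x] at hv
    obtain ⟨y, h1, h2, h3, h4⟩ := hsplit _ (hbb x) v hv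
    exact ⟨y, h1, by simpa only [h1] using h2, h3, by simpa only [h1] using h4⟩

/-- A sequence of labellings, each refining the previous one, deciding all sets `B n`. -/
structure IsTower {X W : Type*} [TopologicalSpace X] (R : W → W → Prop) (B : ℕ → Set X)
    (S : ℕ → Labelling X W) : Prop where
  basis : ∀ (x : X) (U : Set X), IsOpen U → x ∈ U → ∃ n, x ∈ B n ∧ B n ⊆ U
  refines : ∀ n, Refines R (B n) (S n) (S (n + 1))

namespace IsTower

variable {X W : Type*} [TopologicalSpace X] {R : W → W → Prop} {B : ℕ → Set X}
  {S : ℕ → Labelling X W}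

theorem finer (h : IsTower R B S) {n m : ℕ} (hnm : n ≤ m) {x y : X}
    (hxy : (S m).base x = (S m).base y) : (S n).base x = (S n).base y := by
  induction m, hnm using Nat.le_induction with
  | base => exact hxy
  | succ m _ ih => exact ih ((h.refines m).finer x y hxy)

theorem mem_iff (h : IsTower R B S) {n m : ℕ} (hnm : n < m) {x y : X}
    (hxy : (S m).base x = (S m).base y) : x ∈ B n ↔ y ∈ B n :=
  (h.refines n).decides x y (h.finer hnm hxy)

theorem fixed (h : IsTower R B S) {n m : ℕ} (hnm : n ≤ m) {x : X} (hx : (S n).base x = x) :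
    (S m).base x = x ∧ (S m).label x = (S n).label x := by
  induction m, hnm using Nat.le_induction with
  | base => exact ⟨hx, rfl⟩
  | succ m _ ih =>
    have h1 := (h.refines m).base_old x
    have h2 := (h.refines m).label_old x
    rw [ih.1] at h1 h2
    exact ⟨h1, h2.trans ih.2⟩

theorem step (h : IsTower R B S) (htrans : ∀ ⦃u v w⦄, R u v → R v w → R u w)
    {n m : ℕ} (hnm : n ≤ m) (x : X) :
    ((S m).base x = (S n).base x ∧ (S m).label x = (S n).label x) ∨
      R ((S n).label x) ((S m).label x) := by
  induction m, hnm using Nat.le_induction with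
  | base => exact Or.inl ⟨rfl, rfl⟩
  | succ m _ ih =>
    have hs : ((S (m + 1)).base x = (S m).base x ∧ (S (m + 1)).label x = (S m).label x) ∨
        R ((S m).label x) ((S (m + 1)).label x) := by
      refine ((h.refines m).step x).imp_left fun hb => ⟨hb, ?_⟩
      rw [← (S (m + 1)).label_base, hb, (h.refines m).label_old]
    rcases ih with ⟨h1, h2⟩ | h1 <;> rcases hs with ⟨h3, h4⟩ | h3
    · exact Or.inl ⟨h3.trans h1, h4.trans h2⟩
    · exact Or.inr (h2 ▸ h3)
    · exact Or.inr (h4 ▸ h1)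
    · exact Or.inr (htrans h1 h3)

theorem eventually_rel (h : IsTower R B S) [T1Space X]
    (htrans : ∀ ⦃u v w⦄, R u v → R v w → R u w) {n : ℕ} {x : X}
    (hx : (S n).base x ≠ x) : ∃ M, ∀ m ≥ M, R ((S n).label x) ((S m).label x) := by
  obtain ⟨i, hi, hi'⟩ := h.basis x {(S n).base x}ᶜ isOpen_compl_singleton hx.symm
  refine ⟨max n (i + 1), fun m hm => ?_⟩
  rcases h.step htrans (n := n) (m := m) (by omega) x with ⟨h1, -⟩ | h1
  · have h2 := (h.mem_iff (n := i) (m := m) (by omega) ((S m).base_base x)).2 hi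
    exact absurd h1 (hi' h2)
  · exact h1

theorem exists_limit_label (h : IsTower R B S) [T1Space X] [Finite W]
    (htrans : ∀ ⦃u v w⦄, R u v → R v w → R u w)
    (x : X) : ∃ w, (∃ n, (S n).base x = x ∧ (S n).label x = w) ∨
      ((∀ n, (S n).base x ≠ x) ∧ R w w ∧
        ∃ N, ∀ n ≥ N, R ((S n).label x) w ∧ R w ((S n).label x)) := by
  by_cases hx : ∃ n, (S n).base x = x
  · obtain ⟨n, hn⟩ := hx
    exact ⟨_, Or.inl ⟨n, hn, rfl⟩⟩
  · push Not at hx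
    obtain ⟨w, hw⟩ := Finite.exists_infinite_fiber fun n => (S n).label x
    rw [Set.infinite_coe_iff] at hw
    have hfreq : ∀ n, ∃ m > n, (S m).label x = w := fun n => by
      obtain ⟨m, hm, hnm⟩ := hw.exists_gt n
      exact ⟨m, hnm, hm⟩
    obtain ⟨N, -, hN⟩ := hfreq 0
    have hww : R w w := by
      obtain ⟨M, hM⟩ := h.eventually_rel htrans (hx N)
      obtain ⟨m, hm, hmw⟩ := hfreq M
      have := hM m hm.le
      rwa [hN, hmw] at this
    refine ⟨w, Or.inr ⟨hx, hww, N, fun n hn => ⟨?_, ?_⟩⟩⟩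
    · obtain ⟨m, hm, hmw⟩ := hfreq n
      rcases h.step htrans hm.le x with ⟨-, h1⟩ | h1
      · rw [← h1, hmw]; exact hww
      · rwa [hmw] at h1
    · rcases h.step htrans hn x with ⟨-, h1⟩ | h1
      · rw [h1, hN]; exact hww
      · rwa [hN] at h1

/-- A tower has a limit map, which is a d-morphism. -/
theorem exists_limit (h : IsTower R B S) [T1Space X] [Finite W]
    (htrans : ∀ ⦃u v w⦄, R u v → R v w → R u w) :
    ∃ f : X → W, (∀ n x, (S n).base x = x → f x = (S n).label x) ∧
      (∀ x, (∀ n, (S n).base x ≠ x) → R (f x) (f x)) ∧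
      ∀ w, derivedSet (f ⁻¹' {w}) = f ⁻¹' {v | R v w} := by
  choose f hf using h.exists_limit_label htrans
  have hfix : ∀ n x, (S n).base x = x → f x = (S n).label x := by
    intro n x hx
    rcases hf x with ⟨m, hm, hmf⟩ | ⟨hx', -⟩
    · rw [← hmf, ← (h.fixed (le_max_left n m) hx).2, (h.fixed (le_max_right n m) hm).2]
    · exact absurd hx (hx' n)
  have hup : ∀ x, ∃ N, ∀ n ≥ N, (S n).label x = f x ∨ R ((S n).label x) (f x) := by
    intro x
    rcases hf x with ⟨m, hm, hmf⟩ | ⟨-, -, N, hN⟩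
    · exact ⟨m, fun n hn => Or.inl ((h.fixed hn hm).2.trans hmf)⟩
    · exact ⟨N, fun n hn => Or.inr (hN n hn).1⟩
  refine ⟨f, hfix, fun x hx => ?_, fun w => ?_⟩
  · rcases hf x with ⟨m, hm, -⟩ | ⟨-, hr, -⟩
    exacts [absurd hm (hx m), hr]
  ext x
  rw [mem_derivedSet, accPt_iff_nhds]
  simp only [Set.mem_preimage, Set.mem_ofPred_eq]
  constructor
  · intro hacc
    have hn : ∃ n, ∀ y, (S n).base y = (S n).base x → y ≠ x → R (f x) (f y) := by
      rcases hf x with ⟨n, hn, hnf⟩ | ⟨-, -, n, hn⟩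
      · refine ⟨n, fun y hy hyx => ?_⟩
        have hyn : (S n).base y ≠ y := by
          rw [hy, hn]
          exact hyx.symm
        obtain ⟨M, hM⟩ := h.eventually_rel htrans hyn
        obtain ⟨N, hN⟩ := hup y
        have h1 := hM (max M N) (le_max_left _ _)
        rw [(S n).label_congr hy, hnf] at h1
        rcases hN (max M N) (le_max_right _ _) with h2 | h2
        · rwa [h2] at h1
        · exact htrans h1 h2
      · refine ⟨n, fun y hy _ => ?_⟩
        have h1 := (hn n le_rfl).2
        rw [← (S n).label_congr hy] at h1
        obtain ⟨N, hN⟩ := hup y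
        have h2 : R (f x) ((S (max n N)).label y) := by
          rcases h.step htrans (le_max_left n N) y with ⟨-, h2⟩ | h2
          · rwa [h2]
          · exact htrans h1 h2
        rcases hN _ (le_max_right n N) with h3 | h3
        · rwa [h3] at h2
        · exact htrans h2 h3
    obtain ⟨n, hn⟩ := hn
    obtain ⟨y, ⟨hyU, hyw⟩, hyx⟩ := hacc {y | (S n).base y = (S n).base x}
      (((S n).locConst.isOpen_fiber _).mem_nhds rfl)
    have := hn y hyU hyx
    rwa [show f y = w from hyw] at this
  · intro hR U hU
    obtain ⟨V, hVU, hV, hxV⟩ := mem_nhds_iff.1 hU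
    obtain ⟨i, hxi, hiV⟩ := h.basis x V hV hxV
    obtain ⟨N, hN⟩ := hup x
    obtain ⟨K, hK⟩ : ∃ K, ∀ n ≥ K, ∀ k, (S k).base x = x → (S n).base x = x := by
      by_cases hx : ∃ k, (S k).base x = x
      · obtain ⟨k, hk⟩ := hx
        exact ⟨k, fun n hn _ _ => (h.fixed hn hk).1⟩
      · exact ⟨0, fun n _ k hk => absurd ⟨k, hk⟩ hx⟩
    obtain ⟨n, hnN, hni, hnK⟩ : ∃ n, N ≤ n ∧ i < n ∧ K ≤ n :=
      ⟨max N (max (i + 1) K), by omega, by omega, by omega⟩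
    have hRn : R ((S n).label x) w := by
      rcases hN n hnN with h1 | h1
      · rwa [h1]
      · exact htrans h1 hR
    obtain ⟨y, h1, h2, h3, h4⟩ := (h.refines n).split x w hRn
    refine ⟨y, ⟨hVU (hiV ((h.mem_iff hni h1).2 hxi)), (hfix _ y h2).trans h4⟩, ?_⟩
    rintro rfl
    exact h3 (hK n hnK _ h2).symm

end IsTower

end DDMorphism

open DDMorphism in
/-- every zero-dimensional dense-in-itself separable metric space
admits a dd-morphism onto any finite DT1-frame `(W, R, R_D)`. -/
theorem ddMorphism_onto_finite_DT1_frame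
    {X : Type*} [MetricSpace X] [Nonempty X] [SeparableSpace X] [PerfectSpace X]
    (hzd : IsTopologicalBasis {s : Set X | IsClopen s})
    {W : Type*} [Finite W] [Nonempty W] (R RD : W → W → Prop)
    (htrans : Transitive R) (hserial : ∀ w, ∃ v, R w v)
    (hsub : ∀ x y, R x y → RD x y)
    (hdiff : ∀ x y : W, x ≠ y → RD x y)
    (hirr : ∀ x : W, ¬ RD x x → ∀ v, ¬ R v x) :
    ∃ f : X → W, Function.Surjective f ∧
      (∀ w, derivedSet (f ⁻¹' {w}) = f ⁻¹' {v | R v w}) ∧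
      (∀ x y : X, x ≠ y → RD (f x) (f y)) ∧
      (∀ (x : X) (w : W), RD (f x) w → ∃ y : X, y ≠ x ∧ f y = w) := by
  have : SecondCountableTopology X := UniformSpace.secondCountable_of_separable X
  obtain ⟨B, hBc, hB⟩ := exists_clopen_seq hzd
  obtain ⟨d, hd⟩ := hserial (Classical.arbitrary W)
  have hdd : RD d d := by
    by_contra hd'
    exact hirr d hd' _ hd
  -- Labels with `RD w w` get two initial base points, all others exactly one.
  let I := {p : W × Bool // p.2 = true → RD p.1 p.1}
  obtain ⟨z, hz, -⟩ := exists_injective_mem (I := I)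
    (infinite_of_isOpen isOpen_univ (Set.mem_univ (Classical.arbitrary X)))
  obtain ⟨q, m, hq, -, hqq, hmq, hqz, hmz, -, hcov⟩ :=
    exists_partition hBc hB hz (fun i => Set.mem_univ (z i)) (fun i => i.1.1) d 0
  let S₀ : Labelling X W :=
    ⟨q, m, hq, fun x => hqq x (Set.mem_univ x), fun x => hmq x (Set.mem_univ x)⟩
  choose next hnext using exists_refines (X := X) hBc hB hserial
  let S : ℕ → Labelling X W := fun n => Nat.rec S₀ next n
  have hS : IsTower R B S := ⟨hB, fun n => hnext n (S n)⟩
  obtain ⟨f, hfix, hrefl, hder⟩ := hS.exists_limit htrans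
  have hfz : ∀ i, f (z i) = i.1.1 := fun i => (hfix 0 (z i) (hqz i)).trans (hmz i)
  have huniq : ∀ x w, f x = w → ¬ RD w w → x = z ⟨(w, false), by simp⟩ := by
    rintro x _ rfl hx
    have hbase : ∃ n, (S n).base x = x := by
      by_contra! hn
      exact hx (hsub _ _ (hrefl x hn))
    have hroot : (S 0).base x = x := by
      obtain ⟨n, hn⟩ := hbase
      induction n with
      | zero => exact hn
      | succ n ih =>
        rcases (hS.refines n).step x with h | h
        · exact ih (h.symm.trans hn)
        · rw [← hfix (n + 1) x hn] at h
          exact absurd h (hirr _ hx _)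
    have hm : f x = m x := hfix 0 x hroot
    rcases hcov x (Set.mem_univ x) with ⟨⟨⟨w, b⟩, hb⟩, hi⟩ | h
    · have hxz : x = z ⟨(w, b), hb⟩ := hroot.symm.trans hi
      have hw : f x = w := by rw [hxz, hfz]
      subst hw
      cases b with
      | false => exact hxz
      | true => exact absurd (hb rfl) hx
    · rw [hm, h] at hx
      exact absurd hdd hx
  refine ⟨f, fun w => ⟨z ⟨(w, false), by simp⟩, hfz _⟩, hder, fun x y hxy => ?_,
    fun x w hw => ?_⟩
  · by_cases h : f x = f y
    · by_contra hn
      rw [← h] at hn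
      exact hxy ((huniq x _ rfl hn).trans (huniq y _ h.symm hn).symm)
    · exact hdiff _ _ h
  · by_cases hww : RD w w
    · by_cases hx : x = z ⟨(w, false), by simp⟩
      · refine ⟨z ⟨(w, true), fun _ => hww⟩, fun h => ?_, hfz _⟩
        have h' := congrArg (fun i : I => i.1.2) (hz (h.trans hx))
        exact Bool.noConfusion h'
      · exact ⟨_, Ne.symm hx, hfz _⟩
    · refine ⟨z ⟨(w, false), by simp⟩, ?_, hfz _⟩
      rintro rfl
      rw [hfz] at hw
      exact hww hw
end

section
/- Let X and W be sets, S a binary relation on W with w S v for all w ≠ v, and f : X → W a surjective map. Then the following are equivalent: (1) f is a p-morphism from (X, ≠) onto (W, S), i.e. f(x) S f(y) whenever x ≠ y, and whenever f(x) S w there exists y ∈ X with y ≠ x and f(y) = w; (2) f is manifold exactly at the S-reflexive points: for every w ∈ W, w S w holds if and only if f⁻¹(w) has more than one element. -/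
/-- a surjection `f : X → W` onto a frame `(W, S)` whose
reflexive closure of `S` is universal is a p-morphism from `(X, ≠)` onto
`(W, S)` iff `f` is manifold exactly at the `S`-reflexive points. -/
theorem pMorphism_from_difference_iff_manifold_at_reflexive
    {X W : Type*} (S : W → W → Prop)
    (hS : ∀ w v : W, w ≠ v → S w v)
    (f : X → W) (hf : Function.Surjective f) :
    ((∀ x y : X, x ≠ y → S (f x) (f y)) ∧
      (∀ (x : X) (w : W), S (f x) w → ∃ y : X, y ≠ x ∧ f y = w)) ↔
    (∀ w : W, S w w ↔ (f ⁻¹' {w}).Nontrivial) := by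
  constructor
  · rintro ⟨hforth, hback⟩ w
    constructor
    · intro hw
      obtain ⟨x, rfl⟩ := hf w
      obtain ⟨y, hyx, hy⟩ := hback x (f x) hw
      exact ⟨y, hy, x, rfl, hyx⟩
    · rintro ⟨x, rfl, y, hy, hxy⟩
      have hxy' := hforth x y hxy
      rwa [show f y = f x from hy] at hxy'
  · intro h
    refine ⟨fun x y hxy => ?_, fun x w hxw => ?_⟩
    · by_cases hfxy : f x = f y
      · rw [← hfxy]
        exact (h (f x)).2 ⟨x, rfl, y, hfxy.symm, hxy⟩
      · exact hS _ _ hfxy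
    · by_cases hw : f x = w
      · subst hw
        obtain ⟨y, hy, hyx⟩ := ((h (f x)).1 hxw).exists_ne x
        exact ⟨y, hyx, hy⟩
      · obtain ⟨y, rfl⟩ := hf w
        exact ⟨y, fun hyx => hw (congrArg f hyx.symm), rfl⟩
end

section
/- Let (W,R) be a finite connected K4-frame: W finite nonempty, R transitive, and any two points of W joined by a finite chain whose consecutive members are R-comparable (x R± y iff x R y or y R x or x = y). Then for any w, v ∈ W there exists a global path from w to v: a finite sequence w = w₀, w₁, …, w_n = v with w_i R± w_{i+1} for all i < n, such that every u ∈ W satisfies u = w_i or w_i R u for some i ≤ n. -/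
/-- If `w` reaches `u`, a chain from `u` to `v` covering `l` extends to one from `w` to `v`. -/
theorem List.exists_isChain_cons_covering_of_reflTransGen {α : Type*} {r : α → α → Prop}
    {l : List α} {w u v : α} (hwu : Relation.ReflTransGen r w u)
    (hu : ∃ p : List α, List.IsChain r (u :: p) ∧
      (u :: p).getLast (List.cons_ne_nil u p) = v ∧ ∀ x ∈ l, x ∈ u :: p) :
    ∃ p : List α, List.IsChain r (w :: p) ∧
      (w :: p).getLast (List.cons_ne_nil w p) = v ∧ ∀ x ∈ l, x ∈ w :: p := by
  induction hwu using Relation.ReflTransGen.head_induction_on with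
  | refl => exact hu
  | @head a b hab _ ih =>
    obtain ⟨p, hp, hlast, hmem⟩ := ih
    exact ⟨b :: p, List.IsChain.cons_cons hab hp, by simpa using hlast,
      fun x hx => List.mem_cons_of_mem a (hmem x hx)⟩

/-- If any two points are joined by an `r`-chain, then any two points are joined by an `r`-chain
through all members of a given list. -/
theorem List.exists_isChain_cons_covering {α : Type*} {r : α → α → Prop}
    (hconn : ∀ x y, Relation.ReflTransGen r x y) (l : List α) (w v : α) :
    ∃ p : List α, List.IsChain r (w :: p) ∧
      (w :: p).getLast (List.cons_ne_nil w p) = v ∧ ∀ x ∈ l, x ∈ w :: p := by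
  induction l generalizing w with
  | nil =>
    exact List.exists_isChain_cons_covering_of_reflTransGen (hconn w v) ⟨[], by simp⟩
  | cons u l ih =>
    obtain ⟨p, hp, hlast, hmem⟩ := ih u
    refine List.exists_isChain_cons_covering_of_reflTransGen (hconn w u) ⟨p, hp, hlast, ?_⟩
    exact List.forall_mem_cons.2 ⟨List.mem_cons_self, hmem⟩

/-- in a finite connected K4-frame, any two points are joined by
a global path: a finite `R±`-chain from `w` to `v` such that every point of the
frame equals, or is an `R`-successor of, some member of the chain. -/
theorem global_path_in_finite_connected_K4_frame
    {W : Type*} [Finite W] [Nonempty W] (R : W → W → Prop)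
    (htrans : Transitive R)
    (hconn : ∀ x y : W,
      Relation.ReflTransGen (fun a b => R a b ∨ R b a ∨ a = b) x y)
    (w v : W) :
    ∃ (n : ℕ) (c : Fin (n + 1) → W),
      c 0 = w ∧ c (Fin.last n) = v ∧
      (∀ i : Fin n, R (c i.castSucc) (c i.succ) ∨ R (c i.succ) (c i.castSucc) ∨
        c i.castSucc = c i.succ) ∧
      (∀ u : W, ∃ i : Fin (n + 1), u = c i ∨ R (c i) u) := by
  have := Fintype.ofFinite W
  obtain ⟨p, hp, hlast, hmem⟩ :=
    List.exists_isChain_cons_covering hconn (Finset.univ : Finset W).toList w v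
  refine ⟨p.length, fun i => (w :: p).get i, rfl, ?_, fun i => ?_, fun u => ?_⟩
  · rw [← hlast, List.getLast_eq_getElem]
    rfl
  · exact List.isChain_iff_getElem.1 hp i (by simp)
  · obtain ⟨i, hi⟩ := List.get_of_mem (hmem u (by simp))
    exact ⟨i, Or.inl hi.symm⟩
end

section
/- Let F = (W,R,R_D) be a finite rooted DT1CK-frame. Then the set V = {x ∈ W : x R_D x} of R_D-reflexive points is connected in F: any two points of V are joined by a finite chain lying entirely in V whose consecutive members are R-comparable (x R± y iff x R y or y R x or x = y). -/
/-- A finite rooted DT1CK-frame `(W, R, R_D)` (finiteness and nonemptiness of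
`W` are assumed separately as instances). -/
structure IsDT1CKFrame {W : Type*} (R RD : W → W → Prop) : Prop where
  trans : Transitive R
  serial : ∀ x : W, ∃ y, R x y
  sub : ∀ x y : W, R x y → RD x y
  diff : ∀ x y : W, x ≠ y → RD x y
  irrefl_min : ∀ x : W, ¬ RD x x → ∀ v, ¬ R v x
  rooted : ∃ r : W, ∀ w, w = r ∨ R r w
  conn : ∀ x y : W,
    Relation.ReflTransGen (fun a b => R a b ∨ R b a ∨ a = b) x y
  ku : ∀ x : W, ¬ R x x → ∀ y z, R x y → R x z →
    Relation.ReflTransGen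
      (fun a b => (R a b ∨ R b a ∨ a = b) ∧ R x a ∧ R x b) y z

/-- in a finite rooted DT1CK-frame, the set of `R_D`-reflexive
points is connected: any two of them are joined by a finite `R±`-chain lying
entirely among the `R_D`-reflexive points. -/
theorem RD_reflexive_points_connected
    {W : Type*} [Finite W] [Nonempty W] (R RD : W → W → Prop)
    (hF : IsDT1CKFrame R RD) :
    ∀ x y : W, RD x x → RD y y →
      Relation.ReflTransGen
        (fun a b => (R a b ∨ R b a ∨ a = b) ∧ RD a a ∧ RD b b) x y := by
  intro x y hx hy
  obtain ⟨r, hr⟩ := hF.rooted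
  by_cases hrr : RD r r
  · have hxr : R x r ∨ R r x ∨ x = r := (hr x).elim (fun h => .inr (.inr h)) fun h => .inr (.inl h)
    have hry : R r y ∨ R y r ∨ r = y := (hr y).elim (fun h => .inr (.inr h.symm)) .inl
    exact .tail (.single ⟨hxr, hx, hrr⟩) ⟨hry, hrr, hy⟩
  · have hsucc : ∀ w, RD w w → R r w := fun w hw =>
      (hr w).resolve_left fun h => hrr (h ▸ hw)
    have hrefl : ∀ w, R r w → RD w w := fun w hw =>
      by_contra fun h => hF.irrefl_min w h r hw
    exact Relation.ReflTransGen.mono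
      (fun a b ⟨hab, ha, hb⟩ => ⟨hab, hrefl a ha, hrefl b hb⟩) _ _
      (hF.ku r (fun h => hrr (hF.sub r r h)) x y (hsucc x hx) (hsucc y hy))
end
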